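/- arXiv:2508.19041 — 2 statements merged into one kernel-verified Lean document; each statement's English description precedes it below -/
import Mathlib

section
/- In Ω̃₂ (notation of the context), for all t, u, v, w, a, b ∈ T one has Θ(t, u, va, bw) − Θ(t, ub, va, w) − Θ(at, u, v, bw) + Θ(at, ub, v, w) = 0. (Lemma 3.2(3) of the paper, transported through the presentation of the 2-loop space Ω̃₂ given by Theorem 1.1.) -/
open TensorProduct

set_option maxSynthPendingDepth 4

noncomputable section

/-- The symplectic vector space `H = ℚ^{2g}`. -/
abbrev Hsp (g : ℕ) : Type := Fin (2 * g) → ℚ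

/-- The tensor algebra `T = T(H)`. -/
abbrev TA (g : ℕ) : Type := TensorAlgebra ℚ (Hsp g)

/-- The antipode `x ↦ x̄`, determined by `overline (u₁⋯u_m) = (−1)^m u_m⋯u₁`. -/
def barT (g : ℕ) : TA g →ₗ[ℚ] TA g :=
  (MulOpposite.opLinearEquiv ℚ (M := TA g)).symm.toLinearMap ∘ₗ
    (TensorAlgebra.lift ℚ
      ((MulOpposite.opLinearEquiv ℚ (M := TA g)).toLinearMap ∘ₗ
        (-(TensorAlgebra.ι ℚ (M := Hsp g))))).toLinearMap

/-- The coproduct `Δ : T → T ⊗ T`, the algebra homomorphism with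
`Δ(u) = u ⊗ 1 + 1 ⊗ u` for `u ∈ H`. -/
def comul (g : ℕ) : TA g →ₗ[ℚ] TA g ⊗[ℚ] TA g :=
  (TensorAlgebra.lift ℚ
    (((TensorProduct.mk ℚ (TA g) (TA g)).flip 1) ∘ₗ TensorAlgebra.ι ℚ
      + (TensorProduct.mk ℚ (TA g) (TA g) 1) ∘ₗ TensorAlgebra.ι ℚ)).toLinearMap

/-- `T ⊗ T ⊗ T ⊗ T`. -/
abbrev T4 (g : ℕ) : Type := TA g ⊗[ℚ] (TA g ⊗[ℚ] (TA g ⊗[ℚ] TA g))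

/-- The generator `Θ(t,u,v,w)`, i.e. `t ⊗ u ⊗ v ⊗ w`. -/
def Th (g : ℕ) (t u v w : TA g) : T4 g := t ⊗ₜ[ℚ] (u ⊗ₜ[ℚ] (v ⊗ₜ[ℚ] w))

/-- The second term `Θ(t̄′, t″u, v̄′, wv″)` of the (GC3) relation
(Sweedler summation implicit). -/
def gc3B (g : ℕ) (t u v w : TA g) : T4 g :=
  (TensorProduct.assoc ℚ (TA g) (TA g) (TA g ⊗[ℚ] TA g))
    ((TensorProduct.map (barT g) (LinearMap.mulRight ℚ u)) (comul g t) ⊗ₜ[ℚ]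
     (TensorProduct.map (barT g) (LinearMap.mulLeft ℚ w)) (comul g v))

/-- The third term `Θ(tu″, ū′, w″v, w̄′)` of the (GC3) relation
(Sweedler summation implicit). -/
def gc3C (g : ℕ) (t u v w : TA g) : T4 g :=
  (TensorProduct.assoc ℚ (TA g) (TA g) (TA g ⊗[ℚ] TA g))
    ((TensorProduct.comm ℚ (TA g) (TA g)
        ((TensorProduct.map (barT g) (LinearMap.mulLeft ℚ t)) (comul g u))) ⊗ₜ[ℚ]
     (TensorProduct.comm ℚ (TA g) (TA g)
        ((TensorProduct.map (barT g) (LinearMap.mulRight ℚ v)) (comul g w))))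

/-- The full (GC3) element `Θ(t,u,v,w) + Θ(t̄′,t″u,v̄′,wv″) + Θ(tu″,ū′,w″v,w̄′)`. -/
def gc3 (g : ℕ) (t u v w : TA g) : T4 g :=
  Th g t u v w + gc3B g t u v w + gc3C g t u v w

/-- The relations (CS), (HB) and (GC3) defining `Ω̃₂`. -/
def OmegaRel (g : ℕ) : Set (T4 g) :=
  {x | (∃ t u v w : TA g,
          x = Th g t u v w - Th g (barT g v) (barT g w) (barT g t) (barT g u)) ∨
       (∃ t u v w : TA g,
          x = Th g t u v w - Th g (barT g u) (barT g t) (barT g w) (barT g v)) ∨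
       (∃ (t u v w : TA g) (a : Hsp g),
          x = Th g t u v (w * TensorAlgebra.ι ℚ a)
              - Th g t u (TensorAlgebra.ι ℚ a * v) w
              - Th g t (TensorAlgebra.ι ℚ a * u) v w
              + Th g (t * TensorAlgebra.ι ℚ a) u v w) ∨
       (∃ t u v w : TA g, x = gc3 g t u v w)}

/-- The 2-loop space `Ω̃₂`. -/
abbrev Omega2 (g : ℕ) : Type := T4 g ⧸ Submodule.span ℚ (OmegaRel g)

/-- The class `Θ(t,u,v,w) ∈ Ω̃₂`. -/
def ThO (g : ℕ) (t u v w : TA g) : Omega2 g := Submodule.Quotient.mk (Th g t u v w)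

open TensorAlgebra

lemma barT_ι_mul (g : ℕ) (a : Hsp g) (x : TA g) :
    barT g (ι ℚ a * x) = -(barT g x * ι ℚ a) := by
  simp [barT]

lemma barT_mul_ι (g : ℕ) (a : Hsp g) (x : TA g) :
    barT g (x * ι ℚ a) = -(ι ℚ a * barT g x) := by
  simp [barT]

lemma comul_mul (g : ℕ) (x y : TA g) : comul g (x * y) = comul g x * comul g y := by
  simp [comul]

lemma comul_ι (g : ℕ) (a : Hsp g) :
    comul g (ι ℚ a) = ι ℚ a ⊗ₜ[ℚ] (1 : TA g) + (1 : TA g) ⊗ₜ[ℚ] ι ℚ a := by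
  simp [comul]

/-- The relation (HB) in the quotient. -/
lemma ThO_hb (g : ℕ) (t u v w : TA g) (a : Hsp g) :
    ThO g t u v (w * ι ℚ a) - ThO g t u (ι ℚ a * v) w
      - ThO g t (ι ℚ a * u) v w + ThO g (t * ι ℚ a) u v w = 0 :=
  (Submodule.Quotient.mk_eq_zero _).2
    (Submodule.subset_span (Or.inr (Or.inr (Or.inl ⟨t, u, v, w, a, rfl⟩))))

/-- The relation (GC3) in the quotient. -/
lemma ThO_gc3 (g : ℕ) (t u v w : TA g) :
    ThO g t u v w + (Submodule.span ℚ (OmegaRel g)).mkQ (gc3B g t u v w)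
      + (Submodule.span ℚ (OmegaRel g)).mkQ (gc3C g t u v w) = 0 :=
  (Submodule.Quotient.mk_eq_zero _).2
    (Submodule.subset_span (Or.inr (Or.inr (Or.inr ⟨t, u, v, w, rfl⟩))))

lemma mkQ_Th (g : ℕ) (t u v w : TA g) :
    (Submodule.span ℚ (OmegaRel g)).mkQ (t ⊗ₜ[ℚ] (u ⊗ₜ[ℚ] (v ⊗ₜ[ℚ] w))) = ThO g t u v w :=
  rfl

lemma ThO_neg_left (g : ℕ) (t u v w : TA g) : ThO g (-t) u v w = -ThO g t u v w := by
  simp only [← mkQ_Th, TensorProduct.neg_tmul, map_neg]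

lemma ThO_neg_second (g : ℕ) (t u v w : TA g) : ThO g t (-u) v w = -ThO g t u v w := by
  simp only [← mkQ_Th, TensorProduct.neg_tmul, TensorProduct.tmul_neg, map_neg]

lemma ThO_neg_third (g : ℕ) (t u v w : TA g) : ThO g t u (-v) w = -ThO g t u v w := by
  simp only [← mkQ_Th, TensorProduct.neg_tmul, TensorProduct.tmul_neg, map_neg]

lemma ThO_neg_right (g : ℕ) (t u v w : TA g) : ThO g t u v (-w) = -ThO g t u v w := by
  simp only [← mkQ_Th, TensorProduct.tmul_neg, map_neg]

lemma mkQ_gc3B_slide_ι (g : ℕ) (t u v w : TA g) (a : Hsp g) :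
    (Submodule.span ℚ (OmegaRel g)).mkQ (gc3B g t u (v * ι ℚ a) w)
      = (Submodule.span ℚ (OmegaRel g)).mkQ (gc3B g (ι ℚ a * t) u v w) := by
  simp only [gc3B, comul_mul, comul_ι]
  generalize comul g t = X
  generalize comul g v = Y
  induction X using TensorProduct.induction_on with
  | zero => simp
  | add X₁ X₂ h₁ h₂ => simp only [mul_add _ X₁ X₂, add_tmul, map_add, h₁, h₂]
  | tmul p q =>
    induction Y using TensorProduct.induction_on with
    | zero => simp
    | add Y₁ Y₂ h₁ h₂ => simp only [add_mul, tmul_add, map_add, h₁, h₂]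
    | tmul r s =>
      have h := ThO_hb g (barT g p) (q * u) (barT g r) (w * s) a
      simp only [mul_add, add_mul, Algebra.TensorProduct.tmul_mul_tmul, one_mul, mul_one, map_add,
        map_tmul, tmul_add, add_tmul, assoc_tmul, barT_ι_mul, barT_mul_ι, LinearMap.mulLeft_apply,
        LinearMap.mulRight_apply, mkQ_Th, ThO_neg_left, ThO_neg_third, ← mul_assoc] at h ⊢
      rw [← sub_eq_zero, ← h]
      abel

lemma mkQ_gc3C_slide_ι (g : ℕ) (t u v w : TA g) (b : Hsp g) :
    (Submodule.span ℚ (OmegaRel g)).mkQ (gc3C g t u v (ι ℚ b * w))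
      = (Submodule.span ℚ (OmegaRel g)).mkQ (gc3C g t (u * ι ℚ b) v w) := by
  simp only [gc3C, comul_mul, comul_ι]
  generalize comul g u = X
  generalize comul g w = Y
  induction X using TensorProduct.induction_on with
  | zero => simp
  | add X₁ X₂ h₁ h₂ => simp only [add_mul X₁ X₂, add_tmul, map_add, h₁, h₂]
  | tmul p q =>
    induction Y using TensorProduct.induction_on with
    | zero => simp
    | add Y₁ Y₂ h₁ h₂ => simp only [mul_add, tmul_add, map_add, h₁, h₂]
    | tmul r s =>
      have h := ThO_hb g (t * q) (barT g p) (s * v) (barT g r) b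
      simp only [mul_add, add_mul, Algebra.TensorProduct.tmul_mul_tmul, one_mul, mul_one, map_add,
        map_tmul, tmul_add, add_tmul, assoc_tmul, comm_tmul, barT_ι_mul, barT_mul_ι,
        LinearMap.mulLeft_apply, LinearMap.mulRight_apply, mkQ_Th, ThO_neg_second, ThO_neg_right,
        ← mul_assoc] at h ⊢
      rw [← sub_eq_zero, ← neg_eq_zero, ← h]
      abel

/-- The second (GC3) term does not see whether a factor sits at the end of `v` or the start
of `t`. -/
lemma mkQ_gc3B_slide (g : ℕ) (t u v w a : TA g) :
    (Submodule.span ℚ (OmegaRel g)).mkQ (gc3B g t u (v * a) w)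
      = (Submodule.span ℚ (OmegaRel g)).mkQ (gc3B g (a * t) u v w) := by
  induction a using TensorAlgebra.induction generalizing t v with
  | algebraMap r =>
    simp only [gc3B, ← Algebra.commutes r v, ← Algebra.smul_def, map_smul, tmul_smul, smul_tmul']
  | ι a => exact mkQ_gc3B_slide_ι g t u v w a
  | mul a b ha hb => rw [← mul_assoc, hb, ha, mul_assoc]
  | add a b ha hb =>
    have ha' := ha t v
    have hb' := hb t v
    simp only [gc3B, mul_add, add_mul, map_add, tmul_add, add_tmul] at ha' hb' ⊢
    rw [ha', hb']

/-- The third (GC3) term does not see whether a factor sits at the start of `w` or the end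
of `u`. -/
lemma mkQ_gc3C_slide (g : ℕ) (t u v w b : TA g) :
    (Submodule.span ℚ (OmegaRel g)).mkQ (gc3C g t u v (b * w))
      = (Submodule.span ℚ (OmegaRel g)).mkQ (gc3C g t (u * b) v w) := by
  induction b using TensorAlgebra.induction generalizing u w with
  | algebraMap r =>
    simp only [gc3C, ← Algebra.commutes r u, ← Algebra.smul_def, map_smul, tmul_smul, smul_tmul']
  | ι b => exact mkQ_gc3C_slide_ι g t u v w b
  | mul a b ha hb => rw [mul_assoc, ha, hb, mul_assoc]
  | add a b ha hb =>
    have ha' := ha u w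
    have hb' := hb u w
    simp only [gc3C, mul_add, add_mul, map_add, tmul_add, add_tmul] at ha' hb' ⊢
    rw [ha', hb']

/-- Lemma 3.2(3) transported through the presentation of `Ω̃₂`:
`Θ(t,u,va,bw) − Θ(t,ub,va,w) − Θ(at,u,v,bw) + Θ(at,ub,v,w) = 0` in `Ω̃₂`
for all `t,u,v,w,a,b ∈ T`. -/
theorem theta_double_slide (g : ℕ) (hg : 1 ≤ g) (t u v w a b : TA g) :
    ThO g t u (v * a) (b * w) - ThO g t (u * b) (v * a) w
      - ThO g (a * t) u v (b * w) + ThO g (a * t) (u * b) v w = 0 := by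
  have h₁ := ThO_gc3 g t u (v * a) (b * w)
  have h₂ := ThO_gc3 g t (u * b) (v * a) w
  have h₃ := ThO_gc3 g (a * t) u v (b * w)
  have h₄ := ThO_gc3 g (a * t) (u * b) v w
  rw [mkQ_gc3B_slide, mkQ_gc3C_slide] at h₁
  rw [mkQ_gc3B_slide] at h₂
  rw [mkQ_gc3C_slide] at h₃
  rw [add_assoc] at h₁ h₂ h₃ h₄
  rw [eq_neg_of_add_eq_zero_left h₁, eq_neg_of_add_eq_zero_left h₂,
    eq_neg_of_add_eq_zero_left h₃, eq_neg_of_add_eq_zero_left h₄]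
  abel
end
end

section
/- For every g ≥ 2, the ℚ-vector space of GL(H)-equivariant linear maps from C₁₂^{(4)} (the part of total tensor degree 4, i.e. Lie degree 6) to the fourth exterior power Λ⁴H has dimension 6; equivalently, the multiplicity of the irreducible GL-representation [1⁴] = Λ⁴H in C_{1,2}ℋ(6) is 6. (Proposition 4.2 of the paper.) -/
open TensorProduct

set_option maxSynthPendingDepth 4

noncomputable section

/-- The presentation space for `C_{1,2}ℋ`: one copy of `T⊗T⊗T⊗T` for the theta
generators and one for the dumbbell generators. -/
abbrev P2 (g : ℕ) : Type := T4 g × T4 g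

/-- The theta generator in the presentation space. -/
def ThP (g : ℕ) (t u v w : TA g) : P2 g := (Th g t u v w, 0)

/-- The dumbbell generator in the presentation space. -/
def DP (g : ℕ) (t u v w : TA g) : P2 g := (0, Th g t u v w)

/-- The relations (CS), (HB) and (CC) defining `C₁₂ = C_{1,2}ℋ`. -/
def C12Rel (g : ℕ) : Set (P2 g) :=
  {x | (∃ t u v w : TA g,
          x = ThP g t u v w - ThP g (barT g v) (barT g w) (barT g t) (barT g u)) ∨
       (∃ t u v w : TA g,
          x = ThP g t u v w - ThP g (barT g u) (barT g t) (barT g w) (barT g v)) ∨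
       (∃ t u v w : TA g,
          x = DP g t u v w - DP g (barT g v) u (barT g t) w) ∨
       (∃ t u v w : TA g,
          x = DP g t u v w - DP g (barT g u) (barT g t) (barT g w) (barT g v)) ∨
       (∃ (t u v w : TA g) (a : Hsp g),
          x = ThP g t u v (w * TensorAlgebra.ι ℚ a)
              - ThP g t u (TensorAlgebra.ι ℚ a * v) w
              - ThP g t (TensorAlgebra.ι ℚ a * u) v w
              + ThP g (t * TensorAlgebra.ι ℚ a) u v w) ∨
       (∃ (t u v w : TA g) (a : Hsp g),
          x = DP g t u (TensorAlgebra.ι ℚ a * v) w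
              - DP g (t * TensorAlgebra.ι ℚ a) u v w
              - DP g t u v (w * TensorAlgebra.ι ℚ a)
              + DP g t (TensorAlgebra.ι ℚ a * u) v w) ∨
       (∃ t u v w : TA g,
          x = DP g t u v w - ThP g t u v w - ThP g (barT g v) u (barT g t) w)}

/-- The space `C₁₂ = C_{1,2}ℋ`. -/
abbrev C12 (g : ℕ) : Type := P2 g ⧸ Submodule.span ℚ (C12Rel g)

/-- The class `Θ(t,u,v,w) ∈ C₁₂`. -/
def ThC (g : ℕ) (t u v w : TA g) : C12 g := Submodule.Quotient.mk (ThP g t u v w)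

/-- The class `D(t,u,v,w) ∈ C₁₂`. -/
def DC (g : ℕ) (t u v w : TA g) : C12 g := Submodule.Quotient.mk (DP g t u v w)

/-- The element `GC3(t,u,v,w) ∈ C₁₂`. -/
def gc3C12 (g : ℕ) (t u v w : TA g) : C12 g :=
  Submodule.Quotient.mk ((gc3 g t u v w, 0) : P2 g)

/-- The degree-`n` component `H^{⊗n}` of the tensor algebra. -/
def TAdeg (g n : ℕ) : Submodule ℚ (TA g) :=
  (LinearMap.range (TensorAlgebra.ι ℚ : Hsp g →ₗ[ℚ] TA g)) ^ n

/-- The part of `T⊗T⊗T⊗T` of total tensor degree `m`. -/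
def T4deg (g m : ℕ) : Submodule ℚ (T4 g) :=
  Submodule.span ℚ {x | ∃ i j k l : ℕ, i + j + k + l = m ∧
    ∃ t ∈ TAdeg g i, ∃ u ∈ TAdeg g j, ∃ v ∈ TAdeg g k, ∃ w ∈ TAdeg g l,
      x = Th g t u v w}

/-- The part `Ω̃₂^{(m)}` of total tensor degree `m`. -/
def Omega2deg (g m : ℕ) : Submodule ℚ (Omega2 g) :=
  Submodule.map (Submodule.span ℚ (OmegaRel g)).mkQ (T4deg g m)

/-- The part `C₁₂^{(m)}` of total tensor degree `m` (Lie degree `n = m + 2`). -/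
def C12deg (g m : ℕ) : Submodule ℚ (C12 g) :=
  Submodule.map (Submodule.span ℚ (C12Rel g)).mkQ ((T4deg g m).prod (T4deg g m))

/-- The functorial action of a linear endomorphism of `H` on the tensor algebra. -/
def TAmap (g : ℕ) (φ : Hsp g →ₗ[ℚ] Hsp g) : TA g →ₐ[ℚ] TA g :=
  TensorAlgebra.lift ℚ (TensorAlgebra.ι ℚ ∘ₗ φ)

/-- The diagonal action on `T⊗T⊗T⊗T`. -/
def T4map (g : ℕ) (φ : Hsp g →ₗ[ℚ] Hsp g) : T4 g →ₗ[ℚ] T4 g :=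
  TensorProduct.map (TAmap g φ).toLinearMap
    (TensorProduct.map (TAmap g φ).toLinearMap
      (TensorProduct.map (TAmap g φ).toLinearMap (TAmap g φ).toLinearMap))

/-- The diagonal action on the presentation space of `C₁₂`. -/
def P2map (g : ℕ) (φ : Hsp g →ₗ[ℚ] Hsp g) : P2 g →ₗ[ℚ] P2 g :=
  (T4map g φ).prodMap (T4map g φ)

/-- The action of `GL(H)` on polynomials, realizing `MvPolynomial (Fin 2g) ℚ` as the
symmetric algebra `Sym H` via `eᵢ ↦ Xᵢ`. -/
def polyAct (g : ℕ) (σ : Hsp g ≃ₗ[ℚ] Hsp g) :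
    MvPolynomial (Fin (2 * g)) ℚ →ₐ[ℚ] MvPolynomial (Fin (2 * g)) ℚ :=
  MvPolynomial.aeval fun i => ∑ j, MvPolynomial.C (σ (Pi.single i 1) j) * MvPolynomial.X j

/-- The `m`-th symmetric power `Sym^m H`, realized as the homogeneous polynomials of
degree `m`. -/
abbrev SymP (g m : ℕ) : Type := ↥(MvPolynomial.homogeneousSubmodule (Fin (2 * g)) ℚ m)

/-- The space of `GL(H)`-equivariant linear maps `C₁₂^{(m)} → Λ^n H`. -/
def equivC12toLam (g m n : ℕ) :
    Submodule ℚ (↥(C12deg g m) →ₗ[ℚ] ↥(⋀[ℚ]^n (Hsp g))) where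
  carrier := {π | ∀ (σ : Hsp g ≃ₗ[ℚ] Hsp g) (p : P2 g)
      (hx : Submodule.Quotient.mk p ∈ C12deg g m)
      (hy : Submodule.Quotient.mk (P2map g σ.toLinearMap p) ∈ C12deg g m),
      (↑(π ⟨Submodule.Quotient.mk (P2map g σ.toLinearMap p), hy⟩) :
          ExteriorAlgebra ℚ (Hsp g))
        = ExteriorAlgebra.map σ.toLinearMap
            ↑(π ⟨Submodule.Quotient.mk p, hx⟩)}
  add_mem' := by
    intro f₁ f₂ h₁ h₂ σ p hx hy
    simp only [LinearMap.add_apply, Submodule.coe_add, h₁ σ p hx hy, h₂ σ p hx hy, map_add]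
  zero_mem' := by
    intro σ p hx hy
    simp
  smul_mem' := by
    intro c f h σ p hx hy
    simp only [LinearMap.smul_apply, SetLike.val_smul, h σ p hx hy, map_smul]

/-- The space of `GL(H)`-equivariant linear maps `Ω̃₂^{(m)} → Λ^n H`. -/
def equivOmega2toLam (g m n : ℕ) :
    Submodule ℚ (↥(Omega2deg g m) →ₗ[ℚ] ↥(⋀[ℚ]^n (Hsp g))) where
  carrier := {π | ∀ (σ : Hsp g ≃ₗ[ℚ] Hsp g) (x : T4 g)
      (hx : Submodule.Quotient.mk x ∈ Omega2deg g m)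
      (hy : Submodule.Quotient.mk (T4map g σ.toLinearMap x) ∈ Omega2deg g m),
      (↑(π ⟨Submodule.Quotient.mk (T4map g σ.toLinearMap x), hy⟩) :
          ExteriorAlgebra ℚ (Hsp g))
        = ExteriorAlgebra.map σ.toLinearMap
            ↑(π ⟨Submodule.Quotient.mk x, hx⟩)}
  add_mem' := by
    intro f₁ f₂ h₁ h₂ σ p hx hy
    simp only [LinearMap.add_apply, Submodule.coe_add, h₁ σ p hx hy, h₂ σ p hx hy, map_add]
  zero_mem' := by
    intro σ p hx hy
    simp
  smul_mem' := by
    intro c f h σ p hx hy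
    simp only [LinearMap.smul_apply, SetLike.val_smul, h σ p hx hy, map_smul]

/-- The space of `GL(H)`-equivariant linear maps `C₁₂^{(m)} → Sym^n H`. -/
def equivC12toSym (g m n : ℕ) :
    Submodule ℚ (↥(C12deg g m) →ₗ[ℚ] SymP g n) where
  carrier := {π | ∀ (σ : Hsp g ≃ₗ[ℚ] Hsp g) (p : P2 g)
      (hx : Submodule.Quotient.mk p ∈ C12deg g m)
      (hy : Submodule.Quotient.mk (P2map g σ.toLinearMap p) ∈ C12deg g m),
      (↑(π ⟨Submodule.Quotient.mk (P2map g σ.toLinearMap p), hy⟩) :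
          MvPolynomial (Fin (2 * g)) ℚ)
        = polyAct g σ ↑(π ⟨Submodule.Quotient.mk p, hx⟩)}
  add_mem' := by
    intro f₁ f₂ h₁ h₂ σ p hx hy
    simp only [LinearMap.add_apply, Submodule.coe_add, h₁ σ p hx hy, h₂ σ p hx hy, map_add]
  zero_mem' := by
    intro σ p hx hy
    simp
  smul_mem' := by
    intro c f h σ p hx hy
    simp only [LinearMap.smul_apply, SetLike.val_smul, h σ p hx hy, map_smul]

/-- The space of `GL(H)`-equivariant linear maps `Ω̃₂^{(m)} → Sym^n H`. -/
def equivOmega2toSym (g m n : ℕ) :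
    Submodule ℚ (↥(Omega2deg g m) →ₗ[ℚ] SymP g n) where
  carrier := {π | ∀ (σ : Hsp g ≃ₗ[ℚ] Hsp g) (x : T4 g)
      (hx : Submodule.Quotient.mk x ∈ Omega2deg g m)
      (hy : Submodule.Quotient.mk (T4map g σ.toLinearMap x) ∈ Omega2deg g m),
      (↑(π ⟨Submodule.Quotient.mk (T4map g σ.toLinearMap x), hy⟩) :
          MvPolynomial (Fin (2 * g)) ℚ)
        = polyAct g σ ↑(π ⟨Submodule.Quotient.mk x, hx⟩)}
  add_mem' := by
    intro f₁ f₂ h₁ h₂ σ p hx hy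
    simp only [LinearMap.add_apply, Submodule.coe_add, h₁ σ p hx hy, h₂ σ p hx hy, map_add]
  zero_mem' := by
    intro σ p hx hy
    simp
  smul_mem' := by
    intro c f h σ p hx hy
    simp only [LinearMap.smul_apply, SetLike.val_smul, h σ p hx hy, map_smul]

/-! ### The graded projection of the tensor algebra onto the exterior algebra -/

/-- A submodule of the tensor algebra containing `1` and stable under left multiplication by
vectors is everything. -/
theorem TA_mem_of_ι_mul (g : ℕ) (S : Submodule ℚ (TA g)) (h1 : (1 : TA g) ∈ S)
    (hι : ∀ (a : Hsp g) (t : TA g), t ∈ S → TensorAlgebra.ι ℚ a * t ∈ S) (t : TA g) : t ∈ S := by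
  suffices h : ∀ y ∈ S, t * y ∈ S by simpa using h 1 h1
  induction t using TensorAlgebra.induction with
  | algebraMap r =>
    intro y hy
    rw [← Algebra.smul_def]
    exact S.smul_mem r hy
  | ι a => exact hι a
  | mul a b ha hb =>
    intro y hy
    rw [mul_assoc]
    exact ha _ (hb y hy)
  | add a b ha hb =>
    intro y hy
    rw [add_mul]
    exact S.add_mem (ha y hy) (hb y hy)

/-- The algebra map `T(H) → (⋀H)[X]` sending `a ∈ H` to `a X`. -/
def gradedWedge (g : ℕ) : TA g →ₐ[ℚ] Polynomial (ExteriorAlgebra ℚ (Hsp g)) :=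
  TensorAlgebra.lift ℚ
    ((Polynomial.monomial 1 :
      ExteriorAlgebra ℚ (Hsp g) →ₗ[ExteriorAlgebra ℚ (Hsp g)] _).restrictScalars ℚ ∘ₗ
      ExteriorAlgebra.ι ℚ)

/-- The projection of the tensor algebra to its degree `i` part, followed by the projection to
the exterior algebra. -/
def wedgeDeg (g i : ℕ) : TA g →ₗ[ℚ] ExteriorAlgebra ℚ (Hsp g) :=
  (Polynomial.lcoeff (ExteriorAlgebra ℚ (Hsp g)) i).restrictScalars ℚ ∘ₗ
    (gradedWedge g).toLinearMap

theorem gradedWedge_ι (g : ℕ) (a : Hsp g) :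
    gradedWedge g (TensorAlgebra.ι ℚ a) =
      Polynomial.C (ExteriorAlgebra.ι ℚ a) * Polynomial.X := by
  simp [gradedWedge, Polynomial.C_mul_X_eq_monomial]

theorem wedgeDeg_apply (g i : ℕ) (t : TA g) :
    wedgeDeg g i t = (gradedWedge g t).coeff i := rfl

theorem wedgeDeg_one (g i : ℕ) : wedgeDeg g i 1 = if i = 0 then 1 else 0 := by
  simp [wedgeDeg_apply, Polynomial.coeff_one]

theorem wedgeDeg_zero_mul_ι (g : ℕ) (t : TA g) (a : Hsp g) :
    wedgeDeg g 0 (t * TensorAlgebra.ι ℚ a) = 0 := by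
  simp [wedgeDeg_apply, gradedWedge_ι, ← mul_assoc]

theorem wedgeDeg_succ_mul_ι (g i : ℕ) (t : TA g) (a : Hsp g) :
    wedgeDeg g (i + 1) (t * TensorAlgebra.ι ℚ a) = wedgeDeg g i t * ExteriorAlgebra.ι ℚ a := by
  simp [wedgeDeg_apply, gradedWedge_ι, ← mul_assoc]

theorem wedgeDeg_zero_ι_mul (g : ℕ) (t : TA g) (a : Hsp g) :
    wedgeDeg g 0 (TensorAlgebra.ι ℚ a * t) = 0 := by
  simp [wedgeDeg_apply, gradedWedge_ι, Polynomial.mul_coeff_zero]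

theorem wedgeDeg_succ_ι_mul (g i : ℕ) (t : TA g) (a : Hsp g) :
    wedgeDeg g (i + 1) (TensorAlgebra.ι ℚ a * t) = ExteriorAlgebra.ι ℚ a * wedgeDeg g i t := by
  rw [wedgeDeg_apply, map_mul, gradedWedge_ι, mul_assoc, Polynomial.X_mul, Polynomial.coeff_C_mul,
    Polynomial.coeff_mul_X, wedgeDeg_apply]

theorem wedgeDeg_mem (g : ℕ) (t : TA g) : ∀ i, wedgeDeg g i t ∈ ⋀[ℚ]^i (Hsp g) := by
  suffices h : t ∈ (⨅ i, (⋀[ℚ]^i (Hsp g)).comap (wedgeDeg g i) : Submodule ℚ (TA g)) by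
    simpa [Submodule.mem_iInf] using h
  refine TA_mem_of_ι_mul g _ ?_ ?_ t
  · simp only [Submodule.mem_iInf, Submodule.mem_comap, wedgeDeg_one]
    rintro (_ | i)
    · simp
    · simp
  · simp only [Submodule.mem_iInf, Submodule.mem_comap]
    rintro a t ht (_ | i)
    · rw [wedgeDeg_zero_ι_mul]
      exact Submodule.zero_mem _
    · rw [wedgeDeg_succ_ι_mul, ExteriorAlgebra.exteriorPower, pow_succ']
      exact Submodule.mul_mem_mul (LinearMap.mem_range_self _ a) (ht i)

theorem ι_mul_wedgeDeg (g : ℕ) (a : Hsp g) (t : TA g) : ∀ i,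
    ExteriorAlgebra.ι ℚ a * wedgeDeg g i t =
      (-1 : ℚ) ^ i • (wedgeDeg g i t * ExteriorAlgebra.ι ℚ a) := by
  suffices h : t ∈ (⨅ i, LinearMap.eqLocus
      (LinearMap.mulLeft ℚ (ExteriorAlgebra.ι ℚ a) ∘ₗ wedgeDeg g i)
      ((-1 : ℚ) ^ i • (LinearMap.mulRight ℚ (ExteriorAlgebra.ι ℚ a) ∘ₗ wedgeDeg g i)) :
      Submodule ℚ (TA g)) by
    simpa [Submodule.mem_iInf, LinearMap.mem_eqLocus] using h
  refine TA_mem_of_ι_mul g _ ?_ ?_ t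
  · simp only [Submodule.mem_iInf, LinearMap.mem_eqLocus]
    rintro (_ | i) <;> simp [wedgeDeg_one]
  · simp only [Submodule.mem_iInf, LinearMap.mem_eqLocus, LinearMap.coe_comp, Function.comp_apply,
      LinearMap.mulLeft_apply, LinearMap.smul_apply, LinearMap.mulRight_apply]
    rintro b t ht (_ | i)
    · simp [wedgeDeg_zero_ι_mul]
    · rw [wedgeDeg_succ_ι_mul, ← mul_assoc,
        eq_neg_of_add_eq_zero_left (ExteriorAlgebra.ι_add_mul_swap a b), neg_mul, mul_assoc, ht i,
        pow_succ, mul_smul_comm, mul_neg_one, neg_smul, mul_assoc]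

/-- Graded commutativity of the exterior algebra. -/
theorem wedgeDeg_mul_comm (g : ℕ) (u : TA g) (j : ℕ) (t : TA g) : ∀ i,
    wedgeDeg g i t * wedgeDeg g j u =
      (-1 : ℚ) ^ (i * j) • (wedgeDeg g j u * wedgeDeg g i t) := by
  suffices h : t ∈ (⨅ i, LinearMap.eqLocus
      (LinearMap.mulRight ℚ (wedgeDeg g j u) ∘ₗ wedgeDeg g i)
      ((-1 : ℚ) ^ (i * j) • (LinearMap.mulLeft ℚ (wedgeDeg g j u) ∘ₗ wedgeDeg g i)) :
      Submodule ℚ (TA g)) by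
    simpa [Submodule.mem_iInf, LinearMap.mem_eqLocus] using h
  refine TA_mem_of_ι_mul g _ ?_ ?_ t
  · simp only [Submodule.mem_iInf, LinearMap.mem_eqLocus]
    rintro (_ | i) <;> simp [wedgeDeg_one]
  · simp only [Submodule.mem_iInf, LinearMap.mem_eqLocus, LinearMap.coe_comp, Function.comp_apply,
      LinearMap.mulLeft_apply, LinearMap.smul_apply, LinearMap.mulRight_apply]
    rintro b t ht (_ | i)
    · simp [wedgeDeg_zero_ι_mul]
    · rw [wedgeDeg_succ_ι_mul, mul_assoc, ht i, mul_smul_comm, ← mul_assoc, ι_mul_wedgeDeg,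
        smul_mul_assoc, smul_smul, mul_assoc, add_mul i 1 j, one_mul, pow_add]

theorem barT_one (g : ℕ) : barT g 1 = 1 := by
  simp [barT]

theorem barT_ι (g : ℕ) (a : Hsp g) : barT g (TensorAlgebra.ι ℚ a) = -TensorAlgebra.ι ℚ a := by
  simp [barT]

theorem barT_mul (g : ℕ) (s t : TA g) : barT g (s * t) = barT g t * barT g s := by
  simp [barT]

theorem barT_barT (g : ℕ) (t : TA g) : barT g (barT g t) = t := by
  have h := TA_mem_of_ι_mul g (LinearMap.eqLocus (barT g ∘ₗ barT g) LinearMap.id)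
    (by simp [barT_one, LinearMap.mem_eqLocus]) (fun a t ht => by
      simp only [LinearMap.mem_eqLocus, LinearMap.comp_apply, LinearMap.id_apply] at ht ⊢
      simp [barT_mul, barT_ι, ht]) t
  simpa [LinearMap.mem_eqLocus] using h

/-- The sign by which the antipode acts on the exterior power of degree `i`. -/
def barSign (i : ℕ) : ℚ := (-1) ^ (i * (i + 1) / 2)

theorem barSign_succ (i : ℕ) : barSign (i + 1) = (-1) ^ (i + 1) * barSign i := by
  rw [barSign, barSign, ← pow_add]
  congr 1
  rw [show (i + 1) * (i + 1 + 1) = i * (i + 1) + (i + 1) * 2 by ring,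
    Nat.add_mul_div_right _ _ (by norm_num), add_comm]

theorem wedgeDeg_barT (g : ℕ) (t : TA g) : ∀ i,
    wedgeDeg g i (barT g t) = barSign i • wedgeDeg g i t := by
  suffices h : t ∈ (⨅ i, LinearMap.eqLocus (wedgeDeg g i ∘ₗ barT g)
      (barSign i • wedgeDeg g i) : Submodule ℚ (TA g)) by
    simpa [Submodule.mem_iInf, LinearMap.mem_eqLocus] using h
  refine TA_mem_of_ι_mul g _ ?_ ?_ t
  · simp only [Submodule.mem_iInf, LinearMap.mem_eqLocus]
    rintro (_ | i) <;> simp [wedgeDeg_one, barT_one, barSign]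
  · simp only [Submodule.mem_iInf, LinearMap.mem_eqLocus, LinearMap.coe_comp, Function.comp_apply,
      LinearMap.smul_apply]
    rintro b t ht (_ | i)
    · simp [wedgeDeg_zero_ι_mul, barT_mul, barT_ι, wedgeDeg_zero_mul_ι]
    · rw [barT_mul, barT_ι, mul_neg, map_neg, wedgeDeg_succ_mul_ι, ht, wedgeDeg_succ_ι_mul,
        ι_mul_wedgeDeg, barSign_succ, smul_smul, smul_mul_assoc, ← neg_smul]
      congr 1
      rw [pow_succ, mul_right_comm, mul_right_comm _ (-1 : ℚ), ← mul_pow]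
      simp

theorem wedgeDeg_TAmap (g i : ℕ) (φ : Hsp g →ₗ[ℚ] Hsp g) (t : TA g) :
    wedgeDeg g i (TAmap g φ t) = ExteriorAlgebra.map φ (wedgeDeg g i t) := by
  have h : (gradedWedge g).comp (TAmap g φ) =
      (Polynomial.mapAlgHom (ExteriorAlgebra.map φ)).comp (gradedWedge g) := by
    apply TensorAlgebra.hom_ext
    refine LinearMap.ext fun a => ?_
    simp [TAmap, gradedWedge_ι]
  have := congrArg (fun p => Polynomial.coeff p i) (DFunLike.congr_fun h t)
  simpa [wedgeDeg_apply] using this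

/-! ### Weighted wedge products of four tensors -/

/-- The product map `⋀H ⊗ ⋀H ⊗ ⋀H ⊗ ⋀H → ⋀H` precomposed with the projections of
the four factors to degrees `i`, `j`, `k`, `l`. -/
def wedgeMul (g i j k l : ℕ) : T4 g →ₗ[ℚ] ExteriorAlgebra ℚ (Hsp g) :=
  LinearMap.mul' ℚ _ ∘ₗ TensorProduct.map (wedgeDeg g i)
    (LinearMap.mul' ℚ _ ∘ₗ TensorProduct.map (wedgeDeg g j)
      (LinearMap.mul' ℚ _ ∘ₗ TensorProduct.map (wedgeDeg g k) (wedgeDeg g l)))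

theorem wedgeMul_Th (g i j k l : ℕ) (t u v w : TA g) :
    wedgeMul g i j k l (Th g t u v w) =
      wedgeDeg g i t * (wedgeDeg g j u * (wedgeDeg g k v * wedgeDeg g l w)) := by
  simp [wedgeMul, Th]

/-- The wedge product of four tensors, weighted by a function `f` of their degrees (at most `4`). -/
def wedge4 (g : ℕ) (f : ℕ → ℕ → ℕ → ℕ → ℚ) : T4 g →ₗ[ℚ] ExteriorAlgebra ℚ (Hsp g) :=
  ∑ i ∈ Finset.range 5, ∑ j ∈ Finset.range 5, ∑ k ∈ Finset.range 5, ∑ l ∈ Finset.range 5,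
    f i j k l • wedgeMul g i j k l

theorem wedge4_Th (g : ℕ) (f : ℕ → ℕ → ℕ → ℕ → ℚ) (t u v w : TA g) :
    wedge4 g f (Th g t u v w) =
      ∑ i ∈ Finset.range 5, ∑ j ∈ Finset.range 5, ∑ k ∈ Finset.range 5, ∑ l ∈ Finset.range 5,
        f i j k l • (wedgeDeg g i t * (wedgeDeg g j u * (wedgeDeg g k v * wedgeDeg g l w))) := by
  simp [wedge4, LinearMap.sum_apply, wedgeMul_Th]

theorem wedge4_add (g : ℕ) (f f' : ℕ → ℕ → ℕ → ℕ → ℚ) :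
    wedge4 g (f + f') = wedge4 g f + wedge4 g f' := by
  simp [wedge4, add_smul, Finset.sum_add_distrib]

theorem wedge4_zero (g : ℕ) : wedge4 g 0 = 0 := by
  simp [wedge4]

theorem wedgeDeg_mul_left_comm (g : ℕ) (t : TA g) (i : ℕ) (u : TA g) (j : ℕ)
    (x : ExteriorAlgebra ℚ (Hsp g)) :
    wedgeDeg g i t * (wedgeDeg g j u * x) =
      (-1 : ℚ) ^ (i * j) • (wedgeDeg g j u * (wedgeDeg g i t * x)) := by
  rw [← mul_assoc, wedgeDeg_mul_comm, smul_mul_assoc, mul_assoc]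

/-- The effect of `Θ(t,u,v,w) ↦ Θ(v̄,w̄,t̄,ū)` on weights. -/
def twistRot (f : ℕ → ℕ → ℕ → ℕ → ℚ) (i j k l : ℕ) : ℚ :=
  barSign i * barSign j * barSign k * barSign l * (-1) ^ ((i + j) * (k + l)) * f k l i j

/-- The effect of `Θ(t,u,v,w) ↦ Θ(ū,t̄,w̄,v̄)` on weights. -/
def twistFlip (f : ℕ → ℕ → ℕ → ℕ → ℚ) (i j k l : ℕ) : ℚ :=
  barSign i * barSign j * barSign k * barSign l * (-1) ^ (i * j + k * l) * f j i l k

/-- The effect of `Θ(t,u,v,w) ↦ Θ(v̄,u,t̄,w)` on weights. -/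
def twistSwap (f : ℕ → ℕ → ℕ → ℕ → ℚ) (i j k l : ℕ) : ℚ :=
  barSign i * barSign k * (-1) ^ (i * j + j * k + i * k) * f k j i l

/-- The effect of the relation (HB) on weights. -/
def hbWeight (f : ℕ → ℕ → ℕ → ℕ → ℚ) (i j k l : ℕ) : ℚ :=
  f i j k (l + 1) - (-1) ^ (k + l) * f i j (k + 1) l - (-1) ^ (j + k + l) * f i (j + 1) k l
    + (-1) ^ (j + k + l) * f (i + 1) j k l

theorem wedge4_rot (g : ℕ) (f : ℕ → ℕ → ℕ → ℕ → ℚ) (t u v w : TA g) :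
    wedge4 g f (Th g (barT g v) (barT g w) (barT g t) (barT g u)) =
      wedge4 g (twistRot f) (Th g t u v w) := by
  have hs : ∀ (R : Finset ℕ) (F : ℕ → ℕ → ℕ → ℕ → ExteriorAlgebra ℚ (Hsp g)),
      ∑ i ∈ R, ∑ j ∈ R, ∑ k ∈ R, ∑ l ∈ R, F i j k l =
        ∑ i ∈ R, ∑ j ∈ R, ∑ k ∈ R, ∑ l ∈ R, F k l i j := by
    intro R F
    simpa only [Finset.sum_product] using
      Finset.sum_comm (s := R ×ˢ R) (t := R ×ˢ R) (f := fun p q => F p.1 p.2 q.1 q.2)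
  rw [wedge4_Th, wedge4_Th, hs]
  refine Finset.sum_congr rfl fun i _ => Finset.sum_congr rfl fun j _ =>
    Finset.sum_congr rfl fun k _ => Finset.sum_congr rfl fun l _ => ?_
  simp only [wedgeDeg_barT, twistRot, smul_mul_assoc, mul_smul_comm, smul_smul]
  rw [wedgeDeg_mul_left_comm g w l t i, wedgeDeg_mul_comm g u j w l]
  simp only [mul_smul_comm, smul_smul]
  rw [wedgeDeg_mul_left_comm g v k t i, wedgeDeg_mul_left_comm g v k u j]
  simp only [mul_smul_comm, smul_smul]
  congr 1
  ring

theorem wedge4_flip (g : ℕ) (f : ℕ → ℕ → ℕ → ℕ → ℚ) (t u v w : TA g) :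
    wedge4 g f (Th g (barT g u) (barT g t) (barT g w) (barT g v)) =
      wedge4 g (twistFlip f) (Th g t u v w) := by
  have hs : ∀ (R : Finset ℕ) (F : ℕ → ℕ → ℕ → ℕ → ExteriorAlgebra ℚ (Hsp g)),
      ∑ i ∈ R, ∑ j ∈ R, ∑ k ∈ R, ∑ l ∈ R, F i j k l =
        ∑ i ∈ R, ∑ j ∈ R, ∑ k ∈ R, ∑ l ∈ R, F j i l k := by
    intro R F
    rw [Finset.sum_comm]
    refine Finset.sum_congr rfl fun i _ => Finset.sum_congr rfl fun j _ => Finset.sum_comm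
  rw [wedge4_Th, wedge4_Th, hs]
  refine Finset.sum_congr rfl fun i _ => Finset.sum_congr rfl fun j _ =>
    Finset.sum_congr rfl fun k _ => Finset.sum_congr rfl fun l _ => ?_
  simp only [wedgeDeg_barT, twistFlip, smul_mul_assoc, mul_smul_comm, smul_smul]
  rw [wedgeDeg_mul_comm g v k w l, wedgeDeg_mul_left_comm g u j]
  simp only [mul_smul_comm, smul_smul]
  congr 1
  ring

theorem wedge4_swap (g : ℕ) (f : ℕ → ℕ → ℕ → ℕ → ℚ) (t u v w : TA g) :
    wedge4 g f (Th g (barT g v) u (barT g t) w) =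
      wedge4 g (twistSwap f) (Th g t u v w) := by
  have hs : ∀ (R : Finset ℕ) (F : ℕ → ℕ → ℕ → ℕ → ExteriorAlgebra ℚ (Hsp g)),
      ∑ i ∈ R, ∑ j ∈ R, ∑ k ∈ R, ∑ l ∈ R, F i j k l =
        ∑ i ∈ R, ∑ j ∈ R, ∑ k ∈ R, ∑ l ∈ R, F k j i l := by
    intro R F
    rw [Finset.sum_comm]
    conv_rhs => rw [Finset.sum_comm]
    exact Finset.sum_congr rfl fun i _ => Finset.sum_comm
  rw [wedge4_Th, wedge4_Th, hs]
  refine Finset.sum_congr rfl fun i _ => Finset.sum_congr rfl fun j _ =>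
    Finset.sum_congr rfl fun k _ => Finset.sum_congr rfl fun l _ => ?_
  simp only [wedgeDeg_barT, twistSwap, smul_mul_assoc, mul_smul_comm, smul_smul]
  rw [wedgeDeg_mul_left_comm g u j t i, mul_smul_comm, wedgeDeg_mul_left_comm g v k t i,
    wedgeDeg_mul_left_comm g v k u j]
  simp only [mul_smul_comm, smul_smul]
  congr 1
  ring

theorem sum_range_five_shift {M : Type*} [AddCommMonoid M] (F G : ℕ → M) (h0 : F 0 = 0)
    (hs : ∀ i, F (i + 1) = G i) (h4 : G 4 = 0) :
    ∑ i ∈ Finset.range 5, F i = ∑ i ∈ Finset.range 5, G i := by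
  rw [Finset.sum_range_succ', h0, add_zero, Finset.sum_range_succ G, h4, add_zero]
  exact Finset.sum_congr rfl fun i _ => hs i

theorem wedge4_hb (g : ℕ) (f : ℕ → ℕ → ℕ → ℕ → ℚ)
    (hf : ∀ i j k l, i + j + k + l ≠ 4 → f i j k l = 0) (t u v w : TA g) (a : Hsp g) :
    wedge4 g f (Th g t u v (w * TensorAlgebra.ι ℚ a))
      - wedge4 g f (Th g t u (TensorAlgebra.ι ℚ a * v) w)
      - wedge4 g f (Th g t (TensorAlgebra.ι ℚ a * u) v w)
      + wedge4 g f (Th g (t * TensorAlgebra.ι ℚ a) u v w) =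
    wedge4 g (hbWeight f) (Th g t u v w) * ExteriorAlgebra.ι ℚ a := by
  have hw : wedge4 g f (Th g t u v (w * TensorAlgebra.ι ℚ a)) =
      ∑ i ∈ Finset.range 5, ∑ j ∈ Finset.range 5, ∑ k ∈ Finset.range 5, ∑ l ∈ Finset.range 5,
        f i j k (l + 1) • (wedgeDeg g i t * (wedgeDeg g j u *
          (wedgeDeg g k v * (wedgeDeg g l w * ExteriorAlgebra.ι ℚ a)))) := by
    rw [wedge4_Th]
    refine Finset.sum_congr rfl fun i _ => Finset.sum_congr rfl fun j _ =>
      Finset.sum_congr rfl fun k _ => sum_range_five_shift _ _ ?_ ?_ ?_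
    · simp [wedgeDeg_zero_mul_ι]
    · simp [wedgeDeg_succ_mul_ι]
    · rw [hf _ _ _ _ (by omega), zero_smul]
  have hv : wedge4 g f (Th g t u (TensorAlgebra.ι ℚ a * v) w) =
      ∑ i ∈ Finset.range 5, ∑ j ∈ Finset.range 5, ∑ k ∈ Finset.range 5, ∑ l ∈ Finset.range 5,
        f i j (k + 1) l • (wedgeDeg g i t * (wedgeDeg g j u *
          ((ExteriorAlgebra.ι ℚ a * wedgeDeg g k v) * wedgeDeg g l w))) := by
    rw [wedge4_Th]
    refine Finset.sum_congr rfl fun i _ => Finset.sum_congr rfl fun j _ =>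
      sum_range_five_shift _ _ ?_ ?_ ?_
    · simp [wedgeDeg_zero_ι_mul]
    · simp [wedgeDeg_succ_ι_mul]
    · exact Finset.sum_eq_zero fun l _ => by rw [hf _ _ _ _ (by omega), zero_smul]
  have hu : wedge4 g f (Th g t (TensorAlgebra.ι ℚ a * u) v w) =
      ∑ i ∈ Finset.range 5, ∑ j ∈ Finset.range 5, ∑ k ∈ Finset.range 5, ∑ l ∈ Finset.range 5,
        f i (j + 1) k l • (wedgeDeg g i t * ((ExteriorAlgebra.ι ℚ a * wedgeDeg g j u) *
          (wedgeDeg g k v * wedgeDeg g l w))) := by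
    rw [wedge4_Th]
    refine Finset.sum_congr rfl fun i _ => sum_range_five_shift _ _ ?_ ?_ ?_
    · simp [wedgeDeg_zero_ι_mul]
    · simp [wedgeDeg_succ_ι_mul]
    · exact Finset.sum_eq_zero fun k _ => Finset.sum_eq_zero fun l _ => by
        rw [hf _ _ _ _ (by omega), zero_smul]
  have ht : wedge4 g f (Th g (t * TensorAlgebra.ι ℚ a) u v w) =
      ∑ i ∈ Finset.range 5, ∑ j ∈ Finset.range 5, ∑ k ∈ Finset.range 5, ∑ l ∈ Finset.range 5,
        f (i + 1) j k l • ((wedgeDeg g i t * ExteriorAlgebra.ι ℚ a) * (wedgeDeg g j u *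
          (wedgeDeg g k v * wedgeDeg g l w))) := by
    rw [wedge4_Th]
    refine sum_range_five_shift _ _ ?_ ?_ ?_
    · simp [wedgeDeg_zero_mul_ι]
    · simp [wedgeDeg_succ_mul_ι]
    · exact Finset.sum_eq_zero fun j _ => Finset.sum_eq_zero fun k _ =>
        Finset.sum_eq_zero fun l _ => by rw [hf _ _ _ _ (by omega), zero_smul]
  rw [hw, hv, hu, ht, wedge4_Th]
  simp only [Finset.sum_mul, ← Finset.sum_sub_distrib, ← Finset.sum_add_distrib]
  refine Finset.sum_congr rfl fun i _ => Finset.sum_congr rfl fun j _ =>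
    Finset.sum_congr rfl fun k _ => Finset.sum_congr rfl fun l _ => ?_
  have hk : ∀ x, ExteriorAlgebra.ι ℚ a * (wedgeDeg g k v * x) =
      (-1 : ℚ) ^ k • (wedgeDeg g k v * (ExteriorAlgebra.ι ℚ a * x)) := fun x => by
    rw [← mul_assoc, ι_mul_wedgeDeg, smul_mul_assoc, mul_assoc]
  have hj : ∀ x, ExteriorAlgebra.ι ℚ a * (wedgeDeg g j u * x) =
      (-1 : ℚ) ^ j • (wedgeDeg g j u * (ExteriorAlgebra.ι ℚ a * x)) := fun x => by
    rw [← mul_assoc, ι_mul_wedgeDeg, smul_mul_assoc, mul_assoc]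
  simp only [mul_assoc, hj, hk, ι_mul_wedgeDeg g a w l, mul_smul_comm, smul_mul_assoc, smul_smul,
    ← sub_smul, ← add_smul, hbWeight]
  congr 1
  ring

theorem wedge4_mem (g : ℕ) (f : ℕ → ℕ → ℕ → ℕ → ℚ)
    (hf : ∀ i j k l, i + j + k + l ≠ 4 → f i j k l = 0) (x : T4 g) :
    wedge4 g f x ∈ ⋀[ℚ]^4 (Hsp g) := by
  have hmul : ∀ (m n : ℕ) (y z : ExteriorAlgebra ℚ (Hsp g)), y ∈ ⋀[ℚ]^m (Hsp g) →
      z ∈ ⋀[ℚ]^n (Hsp g) → y * z ∈ ⋀[ℚ]^(m + n) (Hsp g) := by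
    intro m n y z hy hz
    rw [ExteriorAlgebra.exteriorPower, pow_add]
    exact Submodule.mul_mem_mul hy hz
  have hm : ∀ i j k l, wedgeMul g i j k l x ∈ ⋀[ℚ]^(i + (j + (k + l))) (Hsp g) := by
    intro i j k l
    refine LinearMap.range_le_iff_comap.mpr ?_ (LinearMap.mem_range_self _ x)
    rw [eq_top_iff, ← TensorProduct.span_tmul_eq_top, Submodule.span_le]
    rintro _ ⟨t, y, rfl⟩
    induction y with
    | zero => simp
    | add a b ha hb => rw [TensorProduct.tmul_add]; exact Submodule.add_mem _ ha hb
    | tmul u y =>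
      induction y with
      | zero => simp
      | add a b ha hb =>
        rw [TensorProduct.tmul_add, TensorProduct.tmul_add]; exact Submodule.add_mem _ ha hb
      | tmul v w =>
        simp only [SetLike.mem_coe, Submodule.mem_comap]
        rw [← Th, wedgeMul_Th]
        exact hmul _ _ _ _ (wedgeDeg_mem g t i) (hmul _ _ _ _ (wedgeDeg_mem g u j)
          (hmul _ _ _ _ (wedgeDeg_mem g v k) (wedgeDeg_mem g w l)))
  simp only [wedge4, LinearMap.sum_apply, LinearMap.smul_apply]
  refine Submodule.sum_mem _ fun i _ => Submodule.sum_mem _ fun j _ =>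
    Submodule.sum_mem _ fun k _ => Submodule.sum_mem _ fun l _ => ?_
  by_cases h : i + j + k + l = 4
  · have h' := hm i j k l
    rw [← add_assoc, ← add_assoc, h] at h'
    exact Submodule.smul_mem _ _ h'
  · rw [hf _ _ _ _ h, zero_smul]
    exact Submodule.zero_mem _

theorem T4map_Th (g : ℕ) (φ : Hsp g →ₗ[ℚ] Hsp g) (t u v w : TA g) :
    T4map g φ (Th g t u v w) =
      Th g (TAmap g φ t) (TAmap g φ u) (TAmap g φ v) (TAmap g φ w) := by
  simp [T4map, Th]

theorem wedge4_T4map (g : ℕ) (f : ℕ → ℕ → ℕ → ℕ → ℚ) (φ : Hsp g →ₗ[ℚ] Hsp g) (x : T4 g) :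
    wedge4 g f (T4map g φ x) = ExteriorAlgebra.map φ (wedge4 g f x) := by
  have h : wedge4 g f ∘ₗ T4map g φ = (ExteriorAlgebra.map φ).toLinearMap ∘ₗ wedge4 g f := by
    refine TensorProduct.ext' fun t y => ?_
    induction y with
    | zero => simp
    | add a b ha hb => rw [TensorProduct.tmul_add, map_add, map_add, ha, hb]
    | tmul u y =>
      induction y with
      | zero => simp
      | add a b ha hb =>
        rw [TensorProduct.tmul_add, TensorProduct.tmul_add, map_add, map_add, ha, hb]
      | tmul v w =>
        rw [← Th, LinearMap.comp_apply, T4map_Th]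
        simp [wedge4_Th, wedgeDeg_TAmap]
  exact LinearMap.congr_fun h x

/-! ### The linear system satisfied by the weights -/

/-- The conditions on a weight function under which `wedge4` descends to the theta part of `C₁₂`
in degree `4`. -/
structure IsThetaWeight (f : ℕ → ℕ → ℕ → ℕ → ℚ) : Prop where
  support : ∀ i j k l, i + j + k + l ≠ 4 → f i j k l = 0
  rot : ∀ i j k l, i + j + k + l = 4 → f i j k l = twistRot f i j k l
  flip : ∀ i j k l, i + j + k + l = 4 → f i j k l = twistFlip f i j k l
  hb : ∀ i j k l, i + j + k + l = 3 → hbWeight f i j k l = 0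

/-- The general solution of the linear system `IsThetaWeight`, in terms of its values at
`(2,0,2,0)`, `(2,1,1,0)`, `(2,2,0,0)`, `(3,0,1,0)`, `(3,1,0,0)` and `(4,0,0,0)`. -/
def thetaWeight (x : Fin 6 → ℚ) (i j k l : ℕ) : ℚ :=
  if i + j + k + l = 4 then
    match i, j, k with
    | 0, 0, 0 => x 5
    | 0, 0, 1 => -x 4
    | 0, 0, 2 => x 2
    | 0, 0, 3 => -x 4
    | 0, 0, 4 => x 5
    | 0, 1, 0 => -x 3
    | 0, 1, 1 => -x 1
    | 0, 1, 2 => x 1 - x 2 + x 4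
    | 0, 1, 3 => x 3 + x 4 - x 5
    | 0, 2, 0 => x 0
    | 0, 2, 1 => -x 0 - x 1 + x 3
    | 0, 2, 2 => x 0 + x 2 - x 5
    | 0, 3, 0 => -x 3
    | 0, 3, 1 => -x 3 - x 4 + x 5
    | 0, 4, 0 => x 5
    | 1, 0, 0 => -x 3 - x 4 + x 5
    | 1, 0, 1 => -x 1 + x 2 - x 4
    | 1, 0, 2 => x 1
    | 1, 0, 3 => x 3
    | 1, 1, 0 => x 0 + x 1 - x 3
    | 1, 1, 1 => -x 0 - 3 * x 1 + x 2 + x 3 - x 4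
    | 1, 1, 2 => x 0 + x 1 - x 3
    | 1, 2, 0 => -x 1
    | 1, 2, 1 => -x 1 + x 2 - x 4
    | 1, 3, 0 => x 4
    | 2, 0, 0 => x 0 + x 2 - x 5
    | 2, 0, 1 => -x 0 - x 1 + x 3
    | 2, 0, 2 => x 0
    | 2, 1, 0 => x 1 - x 2 + x 4
    | 2, 1, 1 => x 1
    | 2, 2, 0 => x 2
    | 3, 0, 0 => x 3 + x 4 - x 5
    | 3, 0, 1 => x 3
    | 3, 1, 0 => x 4
    | 4, 0, 0 => x 5
    | _, _, _ => 0
  else 0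

set_option maxHeartbeats 2000000 in
theorem isThetaWeight_thetaWeight (x : Fin 6 → ℚ) : IsThetaWeight (thetaWeight x) where
  support i j k l h := if_neg h
  rot i j k l h := by
    obtain rfl : l = 4 - (i + j + k) := by omega
    have hi : i ≤ 4 := by omega
    have hj : j ≤ 4 - i := by omega
    have hk : k ≤ 4 - (i + j) := by omega
    clear h
    interval_cases i <;> interval_cases j <;> interval_cases k <;>
      norm_num [twistRot, thetaWeight, barSign] <;> ring
  flip i j k l h := by
    obtain rfl : l = 4 - (i + j + k) := by omega
    have hi : i ≤ 4 := by omega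
    have hj : j ≤ 4 - i := by omega
    have hk : k ≤ 4 - (i + j) := by omega
    clear h
    interval_cases i <;> interval_cases j <;> interval_cases k <;>
      norm_num [twistFlip, thetaWeight, barSign] <;> ring
  hb i j k l h := by
    obtain rfl : l = 3 - (i + j + k) := by omega
    have hi : i ≤ 3 := by omega
    have hj : j ≤ 3 - i := by omega
    have hk : k ≤ 3 - (i + j) := by omega
    clear h
    interval_cases i <;> interval_cases j <;> interval_cases k <;>
      norm_num [hbWeight, thetaWeight] <;> ring

theorem IsThetaWeight.eq_zero {f : ℕ → ℕ → ℕ → ℕ → ℚ} (hf : IsThetaWeight f)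
    (h2020 : f 2 0 2 0 = 0) (h2110 : f 2 1 1 0 = 0) (h2200 : f 2 2 0 0 = 0)
    (h3010 : f 3 0 1 0 = 0) (h3100 : f 3 1 0 0 = 0) (h4000 : f 4 0 0 0 = 0) : f = 0 := by
  have rot : ∀ i j k l, i + j + k + l = 4 → f k l i j = 0 → f i j k l = 0 :=
    fun i j k l h h0 => by rw [hf.rot i j k l h, twistRot, h0, mul_zero]
  have flip : ∀ i j k l, i + j + k + l = 4 → f j i l k = 0 → f i j k l = 0 :=
    fun i j k l h h0 => by rw [hf.flip i j k l h, twistFlip, h0, mul_zero]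
  have h0022 := rot 0 0 2 2 rfl h2200
  have h0031 := rot 0 0 3 1 rfl h3100
  have h0013 := flip 0 0 1 3 rfl h0031
  have h0040 := rot 0 0 4 0 rfl h4000
  have h0004 := flip 0 0 0 4 rfl h0040
  have h0202 := flip 0 2 0 2 rfl h2020
  have h0301 := flip 0 3 0 1 rfl h3010
  have h0400 := rot 0 4 0 0 rfl h0004
  have h1021 := rot 1 0 2 1 rfl h2110
  have h0112 := flip 0 1 1 2 rfl h1021
  have h1030 := rot 1 0 3 0 rfl h3010
  have h0103 := flip 0 1 0 3 rfl h1030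
  have h1201 := rot 1 2 0 1 rfl h0112
  have h1300 := rot 1 3 0 0 rfl h0013
  have h1003 : f 1 0 0 3 = 0 := by
    simpa [hbWeight, h0004, h0013, h0103] using hf.hb 0 0 0 3 rfl
  have h1012 : f 1 0 1 2 = 0 := by
    simpa [hbWeight, h0013, h0022, h0112] using hf.hb 0 0 1 2 rfl
  have h0121 : f 0 1 2 1 = 0 := by
    simpa [hbWeight, h0022, h0031, h1021] using hf.hb 0 0 2 1 rfl
  have h0130 : f 0 1 3 0 = 0 := by
    simpa [hbWeight, h0031, h0040, h1030] using hf.hb 0 0 3 0 rfl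
  have h1102 : f 1 1 0 2 = 0 := by
    simpa [hbWeight, h0103, h0112, h0202] using hf.hb 0 1 0 2 rfl
  have h0211 : f 0 2 1 1 = 0 := by
    simpa [hbWeight, h0202, h0301, h1201] using hf.hb 0 2 0 1 rfl
  have h0310 : f 0 3 1 0 = 0 := by
    simpa [hbWeight, h0301, h0400, h1300] using hf.hb 0 3 0 0 rfl
  have h2002 : f 2 0 0 2 = 0 := by
    simpa [hbWeight, h1003, h1012, h1102] using hf.hb 1 0 0 2 rfl
  have h1120 : f 1 1 2 0 = 0 := by
    simpa [hbWeight, h1021, h1030, h2020] using hf.hb 1 0 2 0 rfl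
  have h1210 : f 1 2 1 0 = 0 := by
    simpa [hbWeight, h1201, h1300, h2200] using hf.hb 1 2 0 0 rfl
  have h2011 : f 2 0 1 1 = 0 := by
    simpa [hbWeight, h2020, h2110, h3010] using hf.hb 2 0 1 0 rfl
  have h2101 : f 2 1 0 1 = 0 := by
    simpa [hbWeight, h2110, h2200, h3100] using hf.hb 2 1 0 0 rfl
  have h3001 : f 3 0 0 1 = 0 := by
    simpa [hbWeight, h3010, h3100, h4000] using hf.hb 3 0 0 0 rfl
  have h0220 := rot 0 2 2 0 rfl h2002
  have h1111 : f 1 1 1 1 = 0 := by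
    simpa [hbWeight, h0112, h0121, h0211] using hf.hb 0 1 1 1 rfl
  funext i j k l
  by_cases h : i + j + k + l = 4
  · obtain rfl : l = 4 - (i + j + k) := by omega
    have hi : i ≤ 4 := by omega
    have hj : j ≤ 4 - i := by omega
    have hk : k ≤ 4 - (i + j) := by omega
    clear h
    interval_cases i <;> interval_cases j <;> interval_cases k <;> assumption
  · exact hf.support i j k l h

/-! ### Monomials -/

/-- The product of standard basis vectors in the tensor algebra. -/
def mon (g : ℕ) (L : List (Fin (2 * g))) : TA g :=
  (L.map fun i => TensorAlgebra.ι ℚ (Pi.single i (1 : ℚ) : Hsp g)).prod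

/-- The product of standard basis vectors in the exterior algebra. -/
def wedgeMon (g : ℕ) (L : List (Fin (2 * g))) : ExteriorAlgebra ℚ (Hsp g) :=
  (L.map fun i => ExteriorAlgebra.ι ℚ (Pi.single i (1 : ℚ) : Hsp g)).prod

theorem mon_cons (g : ℕ) (a : Fin (2 * g)) (L : List (Fin (2 * g))) :
    mon g (a :: L) = TensorAlgebra.ι ℚ (Pi.single a (1 : ℚ) : Hsp g) * mon g L := by
  simp [mon]

theorem mon_append (g : ℕ) (L L' : List (Fin (2 * g))) :
    mon g (L ++ L') = mon g L * mon g L' := by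
  simp [mon]

theorem wedgeMon_append (g : ℕ) (L L' : List (Fin (2 * g))) :
    wedgeMon g (L ++ L') = wedgeMon g L * wedgeMon g L' := by
  simp [wedgeMon]

theorem wedgeDeg_mon (g : ℕ) (L : List (Fin (2 * g))) : ∀ i,
    wedgeDeg g i (mon g L) = if i = L.length then wedgeMon g L else 0 := by
  induction L with
  | nil => intro i; simp [mon, wedgeMon, wedgeDeg_one]
  | cons a L ih =>
    rintro (_ | i)
    · simp [mon_cons, wedgeDeg_zero_ι_mul]
    · rw [mon_cons, wedgeDeg_succ_ι_mul, ih]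
      simp [wedgeMon]

theorem wedge4_mon (g : ℕ) (f : ℕ → ℕ → ℕ → ℕ → ℚ) (L₁ L₂ L₃ L₄ : List (Fin (2 * g)))
    (h : L₁.length + L₂.length + L₃.length + L₄.length ≤ 4) :
    wedge4 g f (Th g (mon g L₁) (mon g L₂) (mon g L₃) (mon g L₄)) =
      f L₁.length L₂.length L₃.length L₄.length • wedgeMon g (L₁ ++ (L₂ ++ (L₃ ++ L₄))) := by
  rw [wedge4_Th, Finset.sum_eq_single_of_mem L₁.length (Finset.mem_range.mpr (by omega)),
    Finset.sum_eq_single_of_mem L₂.length (Finset.mem_range.mpr (by omega)),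
    Finset.sum_eq_single_of_mem L₃.length (Finset.mem_range.mpr (by omega)),
    Finset.sum_eq_single_of_mem L₄.length (Finset.mem_range.mpr (by omega))]
  · simp [wedgeDeg_mon, wedgeMon_append]
  · intro l _ hl
    simp [wedgeDeg_mon, hl]
  · intro k _ hk
    simp [wedgeDeg_mon, hk]
  · intro j _ hj
    simp [wedgeDeg_mon, hj]
  · intro i _ hi
    simp [wedgeDeg_mon, hi]

theorem barT_mon (g : ℕ) (L : List (Fin (2 * g))) :
    barT g (mon g L) = (-1 : ℚ) ^ L.length • mon g L.reverse := by
  induction L with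
  | nil => simp [mon, barT_one]
  | cons a L ih =>
    rw [mon_cons, barT_mul, barT_ι, ih, List.reverse_cons, mon_append, List.length_cons, pow_succ,
      mul_neg_one, neg_smul, mul_neg, smul_mul_assoc]
    simp [mon]

theorem mon_mem_TAdeg (g : ℕ) (L : List (Fin (2 * g))) : mon g L ∈ TAdeg g L.length := by
  induction L with
  | nil => simp [mon, TAdeg]
  | cons a L ih =>
    rw [mon_cons, TAdeg, List.length_cons, pow_succ']
    exact Submodule.mul_mem_mul (LinearMap.mem_range_self _ _) ih

theorem barT_mon_mem_TAdeg (g : ℕ) (L : List (Fin (2 * g))) :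
    barT g (mon g L) ∈ TAdeg g L.length := by
  rw [barT_mon]
  exact Submodule.smul_mem _ _ (by simpa using mon_mem_TAdeg g L.reverse)

theorem TAdeg_eq_span (g n : ℕ) :
    TAdeg g n = Submodule.span ℚ {x | ∃ L : List (Fin (2 * g)), L.length = n ∧ x = mon g L} := by
  apply le_antisymm
  · induction n with
    | zero =>
      rw [TAdeg, pow_zero, Submodule.one_eq_span, Submodule.span_le]
      rintro _ rfl
      exact Submodule.subset_span ⟨[], rfl, by simp [mon]⟩
    | succ n ih =>
      have h1 : LinearMap.range (TensorAlgebra.ι ℚ : Hsp g →ₗ[ℚ] TA g) =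
          Submodule.span ℚ (Set.range fun i =>
            TensorAlgebra.ι ℚ (Pi.single i (1 : ℚ) : Hsp g)) := by
        rw [LinearMap.range_eq_map, ← (Pi.basisFun ℚ (Fin (2 * g))).span_eq, Submodule.map_span,
          ← Set.range_comp]
        congr 2
        funext i
        simp
      rw [TAdeg, pow_succ']
      refine (mul_le_mul_right ih _).trans ?_
      rw [h1, Submodule.span_mul_span, Submodule.span_le]
      rintro _ ⟨_, ⟨i, rfl⟩, _, ⟨L, hL, rfl⟩, rfl⟩
      exact Submodule.subset_span ⟨i :: L, by simp [hL], (mon_cons g i L).symm⟩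
  · rw [Submodule.span_le]
    rintro _ ⟨L, rfl, rfl⟩
    exact mon_mem_TAdeg g L

theorem Th_mem_T4deg (g : ℕ) {i j k l m : ℕ} {t u v w : TA g} (h : i + j + k + l = m)
    (ht : t ∈ TAdeg g i) (hu : u ∈ TAdeg g j) (hv : v ∈ TAdeg g k) (hw : w ∈ TAdeg g l) :
    Th g t u v w ∈ T4deg g m :=
  Submodule.subset_span ⟨i, j, k, l, h, t, ht, u, hu, v, hv, w, hw, rfl⟩

/-- Two linear maps agreeing on monomials of total degree `m` agree on `T4deg g m`. -/
theorem eqOn_T4deg_of_mon (g m : ℕ) {M : Type*} [AddCommGroup M] [Module ℚ M]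
    (P Q : T4 g →ₗ[ℚ] M)
    (h : ∀ L₁ L₂ L₃ L₄ : List (Fin (2 * g)),
      L₁.length + L₂.length + L₃.length + L₄.length = m →
      P (Th g (mon g L₁) (mon g L₂) (mon g L₃) (mon g L₄)) =
        Q (Th g (mon g L₁) (mon g L₂) (mon g L₃) (mon g L₄))) :
    ∀ x ∈ T4deg g m, P x = Q x := by
  suffices hle : T4deg g m ≤ LinearMap.eqLocus P Q from fun x hx => hle hx
  rw [T4deg, Submodule.span_le]
  rintro _ ⟨i, j, k, l, hm, t, ht, u, hu, v, hv, w, hw, rfl⟩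
  rw [TAdeg_eq_span] at ht hu hv hw
  simp only [SetLike.mem_coe, LinearMap.mem_eqLocus]
  induction ht using Submodule.span_induction with
  | zero => simp [Th]
  | add x y _ _ hx hy => simp only [Th, TensorProduct.add_tmul, map_add] at hx hy ⊢; rw [hx, hy]
  | smul c x _ hx => simp only [Th, ← TensorProduct.smul_tmul', map_smul] at hx ⊢; rw [hx]
  | mem t ht =>
  obtain ⟨L₁, rfl, rfl⟩ := ht
  induction hu using Submodule.span_induction with
  | zero => simp [Th]
  | add x y _ _ hx hy =>
    simp only [Th, TensorProduct.add_tmul, TensorProduct.tmul_add, map_add] at hx hy ⊢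
    rw [hx, hy]
  | smul c x _ hx =>
    simp only [Th, ← TensorProduct.smul_tmul', TensorProduct.tmul_smul, map_smul] at hx ⊢
    rw [hx]
  | mem u hu =>
  obtain ⟨L₂, rfl, rfl⟩ := hu
  induction hv using Submodule.span_induction with
  | zero => simp [Th]
  | add x y _ _ hx hy =>
    simp only [Th, TensorProduct.add_tmul, TensorProduct.tmul_add, map_add] at hx hy ⊢
    rw [hx, hy]
  | smul c x _ hx =>
    simp only [Th, ← TensorProduct.smul_tmul', TensorProduct.tmul_smul, map_smul] at hx ⊢
    rw [hx]
  | mem v hv =>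
  obtain ⟨L₃, rfl, rfl⟩ := hv
  induction hw using Submodule.span_induction with
  | zero => simp [Th]
  | add x y _ _ hx hy =>
    simp only [Th, TensorProduct.tmul_add, map_add] at hx hy ⊢
    rw [hx, hy]
  | smul c x _ hx =>
    simp only [Th, TensorProduct.tmul_smul, map_smul] at hx ⊢
    rw [hx]
  | mem w hw =>
  obtain ⟨L₄, rfl, rfl⟩ := hw
  exact h L₁ L₂ L₃ L₄ hm

/-! ### Weights of diagonal automorphisms -/

theorem coe_exteriorPower_map (g n : ℕ) (φ : Hsp g →ₗ[ℚ] Hsp g) (y : ⋀[ℚ]^n (Hsp g)) :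
    (exteriorPower.map n φ y : ExteriorAlgebra ℚ (Hsp g)) = ExteriorAlgebra.map φ y := by
  have h : (⋀[ℚ]^n (Hsp g)).subtype ∘ₗ exteriorPower.map n φ =
      (ExteriorAlgebra.map φ).toLinearMap ∘ₗ (⋀[ℚ]^n (Hsp g)).subtype := by
    apply exteriorPower.linearMap_ext
    ext v
    simp
  exact LinearMap.congr_fun h y

/-- The linear automorphism permuting the standard basis. -/
theorem exists_linearEquiv_perm (g : ℕ) (ρ : Equiv.Perm (Fin (2 * g))) :
    ∃ σ : Hsp g ≃ₗ[ℚ] Hsp g, ∀ a, σ (Pi.single a 1) = Pi.single (ρ a) 1 :=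
  ⟨(Pi.basisFun ℚ _).equiv (Pi.basisFun ℚ _) ρ, fun a => by
    simpa only [Pi.basisFun_apply] using
      (Pi.basisFun ℚ (Fin (2 * g))).equiv_apply a (Pi.basisFun ℚ (Fin (2 * g))) ρ⟩

/-- The linear automorphism scaling the standard basis. -/
theorem exists_linearEquiv_diagonal (g : ℕ) (d : Fin (2 * g) → ℚ) (hd : ∀ a, d a ≠ 0) :
    ∃ σ : Hsp g ≃ₗ[ℚ] Hsp g, ∀ a, σ (Pi.single a 1) = d a • Pi.single a 1 :=
  ⟨(Pi.basisFun ℚ _).equiv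
      ((Pi.basisFun ℚ _).isUnitSMul fun a => isUnit_iff_ne_zero.mpr (hd a)) (Equiv.refl _),
    fun a => by
      simpa only [Pi.basisFun_apply, Module.Basis.isUnitSMul_apply, Equiv.refl_apply] using
        (Pi.basisFun ℚ (Fin (2 * g))).equiv_apply a
          ((Pi.basisFun ℚ _).isUnitSMul fun a => isUnit_iff_ne_zero.mpr (hd a)) (Equiv.refl _)⟩

theorem TAmap_mon_perm (g : ℕ) (φ : Hsp g →ₗ[ℚ] Hsp g) (ρ : Equiv.Perm (Fin (2 * g)))
    (h : ∀ a, φ (Pi.single a 1) = Pi.single (ρ a) 1) (L : List (Fin (2 * g))) :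
    TAmap g φ (mon g L) = mon g (L.map ρ) := by
  simp [TAmap, mon, map_list_prod, Function.comp_def, h]

theorem map_wedgeMon_perm (g : ℕ) (φ : Hsp g →ₗ[ℚ] Hsp g) (ρ : Equiv.Perm (Fin (2 * g)))
    (h : ∀ a, φ (Pi.single a 1) = Pi.single (ρ a) 1) (L : List (Fin (2 * g))) :
    ExteriorAlgebra.map φ (wedgeMon g L) = wedgeMon g (L.map ρ) := by
  simp [wedgeMon, map_list_prod, Function.comp_def, h]

theorem TAmap_mon_diagonal (g : ℕ) (φ : Hsp g →ₗ[ℚ] Hsp g) (d : Fin (2 * g) → ℚ)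
    (h : ∀ a, φ (Pi.single a 1) = d a • Pi.single a 1) (L : List (Fin (2 * g))) :
    TAmap g φ (mon g L) = (L.map d).prod • mon g L := by
  induction L with
  | nil => simp [mon]
  | cons a L ih =>
    rw [mon_cons, map_mul, ih, List.map_cons, List.prod_cons, mul_smul_comm]
    simp [TAmap, h, smul_smul, mul_comm]

/-- Coordinates of an exterior power with respect to the standard basis. -/
abbrev lamBasis (g n : ℕ) :
    Module.Basis (Set.powersetCard (Fin (2 * g)) n) ℚ (⋀[ℚ]^n (Hsp g)) :=
  (Pi.basisFun ℚ (Fin (2 * g))).exteriorPower n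

theorem lamBasis_repr_map_diagonal (g n : ℕ) (φ : Hsp g →ₗ[ℚ] Hsp g) (d : Fin (2 * g) → ℚ)
    (h : ∀ a, φ (Pi.single a 1) = d a • Pi.single a 1) (y : ⋀[ℚ]^n (Hsp g))
    (s : Set.powersetCard (Fin (2 * g)) n) :
    (lamBasis g n).repr (exteriorPower.map n φ y) s =
      (∏ a ∈ s.val, d a) * (lamBasis g n).repr y s := by
  have hB : ∀ r, exteriorPower.map n φ (lamBasis g n r) =
      (∏ a ∈ r.val, d a) • lamBasis g n r := by
    intro r
    have hφ : φ ∘ Pi.basisFun ℚ (Fin (2 * g)) = fun a => d a • Pi.basisFun ℚ (Fin (2 * g)) a := by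
      funext a
      simpa using h a
    rw [exteriorPower.basis_apply, exteriorPower.map_apply_ιMulti_family, hφ]
    have hp : ∏ a ∈ r.val, d a = ∏ i, d (Set.powersetCard.ofFinEmbEquiv.symm r i) := by
      rw [Set.powersetCard.ofFinEmbEquiv_symm_apply]
      conv_lhs => rw [← Finset.map_orderEmbOfFin_univ r.val r.prop, Finset.prod_map]
      rfl
    rw [hp]
    exact (exteriorPower.ιMulti ℚ n).map_smul_univ _ _
  have := (lamBasis g n).ext
    (f₁ := (lamBasis g n).coord s ∘ₗ exteriorPower.map n φ)
    (f₂ := (∏ a ∈ s.val, d a) • (lamBasis g n).coord s) (fun r => by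
      rw [LinearMap.comp_apply, hB]
      by_cases hr : r = s
      · subst hr
        simp
      · simp [hr])
  exact LinearMap.congr_fun this y

/-- If scaling a basis vector scales `y` according to its multiplicity in `L`, then the coordinates
of `y` vanish at each subset whose multiplicities are not those of `L`. -/
theorem lamBasis_repr_eq_zero (g n : ℕ) (L : List (Fin (2 * g))) (y : ⋀[ℚ]^n (Hsp g))
    (hy : ∀ (d : Fin (2 * g) → ℚ) (σ : Hsp g ≃ₗ[ℚ] Hsp g),
      (∀ a, σ (Pi.single a 1) = d a • Pi.single a 1) →
      ExteriorAlgebra.map σ.toLinearMap y = (L.map d).prod • (y : ExteriorAlgebra ℚ (Hsp g)))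
    (s : Set.powersetCard (Fin (2 * g)) n) (a : Fin (2 * g))
    (ha : L.count a ≠ if a ∈ s.val then 1 else 0) : (lamBasis g n).repr y s = 0 := by
  let d : Fin (2 * g) → ℚ := fun b => if b = a then 2 else 1
  have hd : ∀ b, d b ≠ 0 := fun b => by
    by_cases hb : b = a <;> simp [d, hb]
  obtain ⟨σ, hσ⟩ := exists_linearEquiv_diagonal g d hd
  have hmap : exteriorPower.map n σ.toLinearMap y = (L.map d).prod • y :=
    Subtype.ext ((coe_exteriorPower_map g n _ y).trans (hy d σ hσ))
  have hs := lamBasis_repr_map_diagonal g n σ.toLinearMap d hσ y s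
  have hL : (L.map d).prod = 2 ^ L.count a := by
    clear ha hy hmap
    induction L with
    | nil => simp
    | cons b L ih =>
      rw [List.map_cons, List.prod_cons, ih, List.count_cons, pow_add, mul_comm]
      by_cases hb : b = a <;> simp [d, hb]
  have hp : ∏ b ∈ s.val, d b = 2 ^ (if a ∈ s.val then 1 else 0) := by
    by_cases h : a ∈ s.val <;> simp [d, Finset.prod_ite_eq', h]
  rw [hmap, map_smul, Finsupp.smul_apply, smul_eq_mul, hL, hp] at hs
  by_contra hne
  exact ha (Nat.pow_right_injective (le_refl 2) (by exact_mod_cast mul_right_cancel₀ hne hs))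

/-- The list of the first four basis indices. -/
def baseList (g : ℕ) (hg : 2 ≤ g) : List (Fin (2 * g)) :=
  List.ofFn (Fin.castLEOrderEmb (show 4 ≤ 2 * g by omega))

/-- The set of the first four basis indices. -/
def baseSet (g : ℕ) (hg : 2 ≤ g) : Set.powersetCard (Fin (2 * g)) 4 :=
  Set.powersetCard.ofFinEmbEquiv (Fin.castLEOrderEmb (show 4 ≤ 2 * g by omega))

theorem length_baseList (g : ℕ) (hg : 2 ≤ g) : (baseList g hg).length = 4 := by
  simp [baseList]

theorem mem_baseSet (g : ℕ) (hg : 2 ≤ g) (a : Fin (2 * g)) :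
    a ∈ baseSet g hg ↔ a ∈ baseList g hg := by
  rw [← Set.powersetCard.mem_range_ofFinEmbEquiv_symm_iff_mem, baseSet, Equiv.symm_apply_apply,
    baseList, List.mem_ofFn]
  rfl

theorem wedgeMon_baseList (g : ℕ) (hg : 2 ≤ g) :
    wedgeMon g (baseList g hg) = lamBasis g 4 (baseSet g hg) := by
  rw [exteriorPower.basis_apply, exteriorPower.ιMulti_family, baseSet, Equiv.symm_apply_apply,
    exteriorPower.ιMulti_apply_coe, ExteriorAlgebra.ιMulti_apply, wedgeMon, baseList, List.map_ofFn]
  simp [Function.comp_def]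

theorem wedgeMon_baseList_ne_zero (g : ℕ) (hg : 2 ≤ g) : wedgeMon g (baseList g hg) ≠ 0 := by
  rw [wedgeMon_baseList]
  exact fun h => (lamBasis g 4).ne_zero (baseSet g hg) (Subtype.ext h)

theorem wedgeMon_eq_zero (g : ℕ) (L : List (Fin (2 * g))) (hL : ¬ L.Nodup) :
    wedgeMon g L = 0 := by
  have h : wedgeMon g L = ExteriorAlgebra.ιMulti ℚ L.length
      (fun i => (Pi.single (L.get i) (1 : ℚ) : Hsp g)) := by
    rw [ExteriorAlgebra.ιMulti_apply, wedgeMon]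
    conv_lhs => rw [← List.ofFn_get L, List.map_ofFn]
    rfl
  rw [h]
  apply ExteriorAlgebra.ιMulti_eq_zero_of_not_inj
  intro hinj
  refine hL (List.nodup_iff_injective_get.mpr fun i j hij => hinj ?_)
  simp only [hij]

theorem eq_zero_of_weight_of_not_nodup (g n : ℕ) (L : List (Fin (2 * g))) (hL : ¬ L.Nodup)
    (y : ⋀[ℚ]^n (Hsp g))
    (hy : ∀ (d : Fin (2 * g) → ℚ) (σ : Hsp g ≃ₗ[ℚ] Hsp g),
      (∀ a, σ (Pi.single a 1) = d a • Pi.single a 1) →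
      ExteriorAlgebra.map σ.toLinearMap y = (L.map d).prod • (y : ExteriorAlgebra ℚ (Hsp g))) :
    y = 0 := by
  obtain ⟨a, ha⟩ : ∃ a, 1 < L.count a := by
    simpa [List.nodup_iff_count_le_one] using hL
  refine (lamBasis g n).repr.map_eq_zero_iff.mp (Finsupp.ext fun s => ?_)
  refine lamBasis_repr_eq_zero g n L y hy s a ?_
  split_ifs <;> omega

theorem eq_smul_wedgeMon_of_weight (g : ℕ) (hg : 2 ≤ g) (y : ⋀[ℚ]^4 (Hsp g))
    (hy : ∀ (d : Fin (2 * g) → ℚ) (σ : Hsp g ≃ₗ[ℚ] Hsp g),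
      (∀ a, σ (Pi.single a 1) = d a • Pi.single a 1) →
      ExteriorAlgebra.map σ.toLinearMap y =
        ((baseList g hg).map d).prod • (y : ExteriorAlgebra ℚ (Hsp g))) :
    (y : ExteriorAlgebra ℚ (Hsp g)) =
      (lamBasis g 4).coord (baseSet g hg) y • wedgeMon g (baseList g hg) := by
  rw [wedgeMon_baseList, ← Submodule.coe_smul]
  congr 1
  refine (lamBasis g 4).repr.injective (Finsupp.ext fun s => ?_)
  rw [map_smul, Module.Basis.repr_self, Finsupp.smul_single, smul_eq_mul, mul_one,
    Module.Basis.coord_apply, Finsupp.single_apply]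
  split_ifs with hs
  · rw [hs]
  · obtain ⟨a, has, hat⟩ := (Set.powersetCard.exists_mem_notMem_iff_ne _ _).mp hs
    refine lamBasis_repr_eq_zero g 4 _ y hy s a ?_
    rw [if_neg (show a ∉ s.val from hat), Ne, List.count_eq_zero, not_not]
    exact (mem_baseSet g hg a).mp has

/-! ### Equivariant maps are weighted wedge products -/

/-- The monomial of `T ⊗ T ⊗ T ⊗ T` obtained by cutting a list into four pieces, the first three
of which have lengths `i`, `j`, `k`. -/
def sliceTh (g i j k : ℕ) (L : List (Fin (2 * g))) : T4 g :=
  Th g (mon g (L.take i)) (mon g ((L.drop i).take j)) (mon g ((L.drop (i + j)).take k))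
    (mon g (L.drop (i + j + k)))

theorem sliceTh_append (g : ℕ) (L₁ L₂ L₃ L₄ : List (Fin (2 * g))) :
    sliceTh g L₁.length L₂.length L₃.length (L₁ ++ (L₂ ++ (L₃ ++ L₄))) =
      Th g (mon g L₁) (mon g L₂) (mon g L₃) (mon g L₄) := by
  simp only [sliceTh, ← List.drop_drop, List.drop_left, List.take_left]

theorem take_append_slices {α : Type*} (L : List α) (i j k : ℕ) :
    L.take i ++ ((L.drop i).take j ++ ((L.drop (i + j)).take k ++ L.drop (i + j + k))) = L := by
  simp only [← List.drop_drop, List.take_append_drop]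

theorem sliceTh_mem_T4deg (g : ℕ) {i j k l m : ℕ} (L : List (Fin (2 * g))) (h : L.length = m)
    (hm : i + j + k + l = m) : sliceTh g i j k L ∈ T4deg g m := by
  refine Th_mem_T4deg g ?_ (mon_mem_TAdeg g _) (mon_mem_TAdeg g _) (mon_mem_TAdeg g _)
    (mon_mem_TAdeg g _)
  simp only [List.length_take, List.length_drop]
  omega

/-- The weight function of an equivariant map: its coordinates at the slicings of the
base list. -/
def equivWeight (g : ℕ) (hg : 2 ≤ g) (P : T4 g →ₗ[ℚ] ⋀[ℚ]^4 (Hsp g)) (i j k l : ℕ) : ℚ :=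
  if i + j + k + l = 4 then
    (lamBasis g 4).coord (baseSet g hg) (P (sliceTh g i j k (baseList g hg)))
  else 0

theorem T4map_diagonal (g : ℕ) (φ : Hsp g →ₗ[ℚ] Hsp g) (d : Fin (2 * g) → ℚ)
    (h : ∀ a, φ (Pi.single a 1) = d a • Pi.single a 1) (L₁ L₂ L₃ L₄ : List (Fin (2 * g))) :
    T4map g φ (Th g (mon g L₁) (mon g L₂) (mon g L₃) (mon g L₄)) =
      ((L₁ ++ (L₂ ++ (L₃ ++ L₄))).map d).prod •
        Th g (mon g L₁) (mon g L₂) (mon g L₃) (mon g L₄) := by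
  rw [T4map_Th]
  simp only [TAmap_mon_diagonal g φ d h, Th, ← TensorProduct.smul_tmul', TensorProduct.tmul_smul,
    smul_smul, List.map_append, List.prod_append]
  congr 1
  ring

theorem exists_perm_map_baseList (g : ℕ) (hg : 2 ≤ g) (L : List (Fin (2 * g)))
    (hL : L.Nodup) (h4 : L.length = 4) :
    ∃ ρ : Equiv.Perm (Fin (2 * g)), (baseList g hg).map ρ = L := by
  obtain ⟨ρ, hρ⟩ := Equiv.Perm.exists_extending_pair
    (Fin.castLEOrderEmb (show 4 ≤ 2 * g by omega)) (fun i : Fin 4 => L.get (i.cast h4.symm))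
    (RelEmbedding.injective _)
    ((List.nodup_iff_injective_get.mp hL).comp (Fin.cast_injective _))
  refine ⟨ρ, ?_⟩
  rw [baseList, List.map_ofFn]
  simp only [Function.comp_def, hρ]
  exact List.ext_getElem (by simp [h4]) fun _ _ _ => by
    simp only [List.getElem_ofFn, List.get_eq_getElem, Fin.val_cast]

/-- An equivariant map `T ⊗ T ⊗ T ⊗ T → Λ⁴H` in degree `4` is a weighted wedge product. -/
theorem eq_wedge4_of_equivariant (g : ℕ) (hg : 2 ≤ g) (P : T4 g →ₗ[ℚ] ⋀[ℚ]^4 (Hsp g))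
    (hP : ∀ (σ : Hsp g ≃ₗ[ℚ] Hsp g), ∀ x ∈ T4deg g 4,
      (P (T4map g σ.toLinearMap x) : ExteriorAlgebra ℚ (Hsp g)) =
        ExteriorAlgebra.map σ.toLinearMap (P x)) :
    ∀ x ∈ T4deg g 4, (P x : ExteriorAlgebra ℚ (Hsp g)) = wedge4 g (equivWeight g hg P) x := by
  have hw : ∀ L₁ L₂ L₃ L₄ : List (Fin (2 * g)),
      L₁.length + L₂.length + L₃.length + L₄.length = 4 →
      ∀ (d : Fin (2 * g) → ℚ) (σ : Hsp g ≃ₗ[ℚ] Hsp g),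
      (∀ a, σ (Pi.single a 1) = d a • Pi.single a 1) →
      ExteriorAlgebra.map σ.toLinearMap
        (P (Th g (mon g L₁) (mon g L₂) (mon g L₃) (mon g L₄)) : ExteriorAlgebra ℚ (Hsp g)) =
        ((L₁ ++ (L₂ ++ (L₃ ++ L₄))).map d).prod •
          (P (Th g (mon g L₁) (mon g L₂) (mon g L₃) (mon g L₄)) :
            ExteriorAlgebra ℚ (Hsp g)) := by
    intro L₁ L₂ L₃ L₄ h d σ hσ
    rw [← hP σ _ (Th_mem_T4deg g h (mon_mem_TAdeg g _) (mon_mem_TAdeg g _) (mon_mem_TAdeg g _)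
      (mon_mem_TAdeg g _)), T4map_diagonal g σ.toLinearMap d hσ, map_smul, Submodule.coe_smul]
  refine eqOn_T4deg_of_mon g 4 ((⋀[ℚ]^4 (Hsp g)).subtype ∘ₗ P) (wedge4 g (equivWeight g hg P)) ?_
  intro L₁ L₂ L₃ L₄ h
  rw [wedge4_mon g _ _ _ _ _ h.le, LinearMap.comp_apply, Submodule.subtype_apply]
  by_cases hL : (L₁ ++ (L₂ ++ (L₃ ++ L₄))).Nodup
  · obtain ⟨ρ, hρ⟩ := exists_perm_map_baseList g hg _ hL (by simp only [List.length_append]; omega)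
    obtain ⟨σ, hσ⟩ := exists_linearEquiv_perm g ρ
    have hbase : (P (sliceTh g L₁.length L₂.length L₃.length (baseList g hg)) :
        ExteriorAlgebra ℚ (Hsp g)) =
        equivWeight g hg P L₁.length L₂.length L₃.length L₄.length •
          wedgeMon g (baseList g hg) := by
      rw [equivWeight, if_pos h]
      refine eq_smul_wedgeMon_of_weight g hg _ fun d σ hσ => ?_
      have hsum := length_baseList g hg
      rw [sliceTh, hw _ _ _ _ (by simp only [List.length_take, List.length_drop]; omega) d σ hσ]
      congr 4
      exact take_append_slices _ _ _ _
    have hmap : Th g (mon g L₁) (mon g L₂) (mon g L₃) (mon g L₄) =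
        T4map g σ.toLinearMap (sliceTh g L₁.length L₂.length L₃.length (baseList g hg)) := by
      rw [sliceTh, T4map_Th]
      simp only [TAmap_mon_perm g σ.toLinearMap ρ hσ, List.map_take, List.map_drop, hρ]
      exact (sliceTh_append g L₁ L₂ L₃ L₄).symm
    rw [hmap, hP σ _ (sliceTh_mem_T4deg g _ (length_baseList g hg) h), hbase, map_smul,
      map_wedgeMon_perm g σ.toLinearMap ρ hσ, hρ]
  · rw [eq_zero_of_weight_of_not_nodup g 4 _ hL _ (hw L₁ L₂ L₃ L₄ h), wedgeMon_eq_zero g _ hL,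
      smul_zero, Submodule.coe_zero]

theorem exists_baseList_slices (g : ℕ) (hg : 2 ≤ g) (i j k l : ℕ) (h : i + j + k + l = 4) :
    ∃ L₁ L₂ L₃ L₄ : List (Fin (2 * g)), L₁.length = i ∧ L₂.length = j ∧ L₃.length = k ∧
      L₄.length = l ∧ L₁ ++ (L₂ ++ (L₃ ++ L₄)) = baseList g hg := by
  have hsum := length_baseList g hg
  refine ⟨(baseList g hg).take i, ((baseList g hg).drop i).take j,
    ((baseList g hg).drop (i + j)).take k, (baseList g hg).drop (i + j + k), ?_, ?_, ?_, ?_, ?_⟩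
  any_goals
    simp only [List.length_take, List.length_drop]
    omega
  exact take_append_slices _ _ _ _

/-- The weights of an equivariant map killing the theta relations. -/
theorem isThetaWeight_equivWeight (g : ℕ) (hg : 2 ≤ g) (P : T4 g →ₗ[ℚ] ⋀[ℚ]^4 (Hsp g))
    (hP : ∀ (σ : Hsp g ≃ₗ[ℚ] Hsp g), ∀ x ∈ T4deg g 4,
      (P (T4map g σ.toLinearMap x) : ExteriorAlgebra ℚ (Hsp g)) =
        ExteriorAlgebra.map σ.toLinearMap (P x))
    (hrot : ∀ t u v w : TA g,
      P (Th g t u v w) = P (Th g (barT g v) (barT g w) (barT g t) (barT g u)))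
    (hflip : ∀ t u v w : TA g,
      P (Th g t u v w) = P (Th g (barT g u) (barT g t) (barT g w) (barT g v)))
    (hhb : ∀ (t u v w : TA g) (a : Hsp g),
      P (Th g t u v (w * TensorAlgebra.ι ℚ a)) - P (Th g t u (TensorAlgebra.ι ℚ a * v) w)
        - P (Th g t (TensorAlgebra.ι ℚ a * u) v w) + P (Th g (t * TensorAlgebra.ι ℚ a) u v w) = 0) :
    IsThetaWeight (equivWeight g hg P) := by
  have hP4 := eq_wedge4_of_equivariant g hg P hP
  have hsupp : ∀ i j k l, i + j + k + l ≠ 4 → equivWeight g hg P i j k l = 0 :=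
    fun i j k l h => if_neg h
  refine ⟨hsupp, fun i j k l h => ?_, fun i j k l h => ?_, fun i j k l h => ?_⟩
  · obtain ⟨L₁, L₂, L₃, L₄, rfl, rfl, rfl, rfl, hL⟩ := exists_baseList_slices g hg i j k l h
    have := congrArg (Subtype.val) (hrot (mon g L₁) (mon g L₂) (mon g L₃) (mon g L₄))
    rw [hP4 _ (Th_mem_T4deg g h (mon_mem_TAdeg g _) (mon_mem_TAdeg g _) (mon_mem_TAdeg g _)
        (mon_mem_TAdeg g _)),
      hP4 _ (Th_mem_T4deg g (by omega) (barT_mon_mem_TAdeg g L₃) (barT_mon_mem_TAdeg g L₄)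
        (barT_mon_mem_TAdeg g L₁) (barT_mon_mem_TAdeg g L₂)), wedge4_rot,
      wedge4_mon g _ _ _ _ _ h.le, wedge4_mon g _ _ _ _ _ h.le, hL] at this
    exact smul_left_injective ℚ (wedgeMon_baseList_ne_zero g hg) this
  · obtain ⟨L₁, L₂, L₃, L₄, rfl, rfl, rfl, rfl, hL⟩ := exists_baseList_slices g hg i j k l h
    have := congrArg (Subtype.val) (hflip (mon g L₁) (mon g L₂) (mon g L₃) (mon g L₄))
    rw [hP4 _ (Th_mem_T4deg g h (mon_mem_TAdeg g _) (mon_mem_TAdeg g _) (mon_mem_TAdeg g _)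
        (mon_mem_TAdeg g _)),
      hP4 _ (Th_mem_T4deg g (by omega) (barT_mon_mem_TAdeg g L₂) (barT_mon_mem_TAdeg g L₁)
        (barT_mon_mem_TAdeg g L₄) (barT_mon_mem_TAdeg g L₃)), wedge4_flip,
      wedge4_mon g _ _ _ _ _ h.le, wedge4_mon g _ _ _ _ _ h.le, hL] at this
    exact smul_left_injective ℚ (wedgeMon_baseList_ne_zero g hg) this
  · obtain ⟨L₁, L₂, L₃, L, rfl, rfl, rfl, hl, hL⟩ :=
      exists_baseList_slices g hg i j k (l + 1) (by omega)
    obtain ⟨L₄, a, rfl⟩ : ∃ L₄ a, L = L₄ ++ [a] :=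
      ⟨L.dropLast, L.getLast (by rintro rfl; simp at hl), (List.dropLast_append_getLast _).symm⟩
    obtain rfl : L₄.length = l := by simpa using hl
    have hι : TensorAlgebra.ι ℚ (Pi.single a (1 : ℚ) : Hsp g) = mon g [a] := by simp [mon]
    have hι' : ExteriorAlgebra.ι ℚ (Pi.single a (1 : ℚ) : Hsp g) = wedgeMon g [a] := by
      simp [wedgeMon]
    have key := wedge4_hb g _ hsupp (mon g L₁) (mon g L₂) (mon g L₃) (mon g L₄) (Pi.single a 1)
    have h0 := congrArg Subtype.val
      (hhb (mon g L₁) (mon g L₂) (mon g L₃) (mon g L₄) (Pi.single a 1))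
    rw [hι] at key h0
    simp only [← mon_append] at key h0
    have hmem : ∀ M₁ M₂ M₃ M₄ : List (Fin (2 * g)),
        M₁.length + M₂.length + M₃.length + M₄.length = 4 →
        wedge4 g (equivWeight g hg P) (Th g (mon g M₁) (mon g M₂) (mon g M₃) (mon g M₄)) =
          P (Th g (mon g M₁) (mon g M₂) (mon g M₃) (mon g M₄)) := fun M₁ M₂ M₃ M₄ hM =>
      (hP4 _ (Th_mem_T4deg g hM (mon_mem_TAdeg g _) (mon_mem_TAdeg g _) (mon_mem_TAdeg g _)
        (mon_mem_TAdeg g _))).symm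
    rw [hmem _ _ _ _ (by simp only [List.length_append, List.length_singleton]; omega),
      hmem _ _ _ _ (by simp only [List.length_append, List.length_singleton]; omega),
      hmem _ _ _ _ (by simp only [List.length_append, List.length_singleton]; omega),
      hmem _ _ _ _ (by simp only [List.length_append, List.length_singleton]; omega)] at key
    have h1 := key.symm.trans h0
    rw [wedge4_mon g _ _ _ _ _ (by omega), hι', smul_mul_assoc, ← wedgeMon_append,
      List.append_assoc, List.append_assoc, List.append_assoc, hL] at h1
    exact (smul_eq_zero.mp h1).resolve_right (wedgeMon_baseList_ne_zero g hg)

/-! ### The presentation of `C₁₂` -/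

theorem TAmap_mem_TAdeg (g : ℕ) (φ : Hsp g →ₗ[ℚ] Hsp g) {n : ℕ} {t : TA g}
    (ht : t ∈ TAdeg g n) : TAmap g φ t ∈ TAdeg g n := by
  have hle : (LinearMap.range (TensorAlgebra.ι ℚ : Hsp g →ₗ[ℚ] TA g)).map
      (TAmap g φ).toLinearMap ≤ LinearMap.range (TensorAlgebra.ι ℚ) := by
    rintro _ ⟨_, ⟨a, rfl⟩, rfl⟩
    exact ⟨φ a, by simp [TAmap]⟩
  have h := Submodule.mem_map_of_mem (f := (TAmap g φ).toLinearMap) ht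
  rw [TAdeg, Submodule.map_pow] at h
  exact pow_le_pow_left' hle n h

theorem T4map_mem_T4deg (g : ℕ) (φ : Hsp g →ₗ[ℚ] Hsp g) {m : ℕ} {x : T4 g}
    (hx : x ∈ T4deg g m) : T4map g φ x ∈ T4deg g m := by
  have hle : T4deg g m ≤ (T4deg g m).comap (T4map g φ) := by
    refine Submodule.span_le.mpr ?_
    rintro _ ⟨i, j, k, l, h, t, ht, u, hu, v, hv, w, hw, rfl⟩
    rw [SetLike.mem_coe, Submodule.mem_comap, T4map_Th]
    exact Th_mem_T4deg g h (TAmap_mem_TAdeg g φ ht) (TAmap_mem_TAdeg g φ hu)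
      (TAmap_mem_TAdeg g φ hv) (TAmap_mem_TAdeg g φ hw)
  exact hle hx

theorem mk_mem_C12deg (g : ℕ) {m : ℕ} {p : P2 g} (h₁ : p.1 ∈ T4deg g m) (h₂ : p.2 ∈ T4deg g m) :
    (Submodule.Quotient.mk p : C12 g) ∈ C12deg g m :=
  Submodule.mem_map_of_mem (f := (Submodule.span ℚ (C12Rel g)).mkQ)
    (Submodule.mem_prod.mpr ⟨h₁, h₂⟩)

theorem ThC_rot (g : ℕ) (t u v w : TA g) :
    ThC g t u v w = ThC g (barT g v) (barT g w) (barT g t) (barT g u) :=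
  (Submodule.Quotient.eq _).mpr (Submodule.subset_span (Or.inl ⟨t, u, v, w, rfl⟩))

theorem ThC_flip (g : ℕ) (t u v w : TA g) :
    ThC g t u v w = ThC g (barT g u) (barT g t) (barT g w) (barT g v) :=
  (Submodule.Quotient.eq _).mpr (Submodule.subset_span (Or.inr (Or.inl ⟨t, u, v, w, rfl⟩)))

theorem ThC_hb (g : ℕ) (t u v w : TA g) (a : Hsp g) :
    ThC g t u v (w * TensorAlgebra.ι ℚ a) - ThC g t u (TensorAlgebra.ι ℚ a * v) w
      - ThC g t (TensorAlgebra.ι ℚ a * u) v w + ThC g (t * TensorAlgebra.ι ℚ a) u v w = 0 :=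
  (Submodule.Quotient.mk_eq_zero _).mpr (Submodule.subset_span
    (Or.inr (Or.inr (Or.inr (Or.inr (Or.inl ⟨t, u, v, w, a, rfl⟩))))))

theorem DC_eq (g : ℕ) (t u v w : TA g) :
    DC g t u v w = ThC g t u v w + ThC g (barT g v) u (barT g t) w := by
  rw [← sub_eq_zero, ← sub_sub]
  exact (Submodule.Quotient.mk_eq_zero _).mpr (Submodule.subset_span
    (Or.inr (Or.inr (Or.inr (Or.inr (Or.inr (Or.inr ⟨t, u, v, w, rfl⟩)))))))

/-- A linear map killing the theta part of `C₁₂^{(m)}` kills all of `C₁₂^{(m)}`. -/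
theorem eq_zero_of_theta_eq_zero {M : Type*} [AddCommGroup M] [Module ℚ M] (g m : ℕ)
    (π : C12 g →ₗ[ℚ] M)
    (h : ∀ x ∈ T4deg g m, π (Submodule.Quotient.mk ((x, 0) : P2 g)) = 0) :
    ∀ y ∈ C12deg g m, π y = 0 := by
  have hD : ∀ x ∈ T4deg g m,
      (π ∘ₗ (Submodule.span ℚ (C12Rel g)).mkQ ∘ₗ LinearMap.inr ℚ (T4 g) (T4 g)) x =
        (0 : T4 g →ₗ[ℚ] M) x := by
    refine eqOn_T4deg_of_mon g m _ _ fun L₁ L₂ L₃ L₄ hL => ?_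
    change π (DC g _ _ _ _) = 0
    rw [DC_eq, map_add]
    refine (congrArg₂ (· + ·)
      (h _ (Th_mem_T4deg g hL (mon_mem_TAdeg g _) (mon_mem_TAdeg g _) (mon_mem_TAdeg g _)
        (mon_mem_TAdeg g _)))
      (h _ (Th_mem_T4deg g (by omega) (barT_mon_mem_TAdeg g L₃) (mon_mem_TAdeg g L₂)
        (barT_mon_mem_TAdeg g L₁) (mon_mem_TAdeg g L₄)))).trans (add_zero 0)
  rintro _ ⟨⟨x, y⟩, hxy, rfl⟩
  obtain ⟨hx, hy⟩ := Submodule.mem_prod.mp hxy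
  have hsplit : ((x, y) : P2 g) = (x, 0) + (0, y) := by simp
  rw [hsplit, map_add, map_add]
  exact (congrArg₂ (· + ·) (h x hx) (hD y hy)).trans (add_zero 0)

/-! ### The classifying map -/

/-- The six degree patterns on which an equivariant map is determined. -/
def slicePattern : Fin 6 → ℕ × ℕ × ℕ :=
  ![(2, 0, 2), (2, 1, 1), (2, 2, 0), (3, 0, 1), (3, 1, 0), (4, 0, 0)]

theorem slicePattern_le (n : Fin 6) :
    (slicePattern n).1 + (slicePattern n).2.1 + (slicePattern n).2.2 ≤ 4 := by
  fin_cases n <;> simp [slicePattern]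

theorem mk_sliceTh_mem (g : ℕ) (hg : 2 ≤ g) (n : Fin 6) :
    (Submodule.Quotient.mk ((sliceTh g (slicePattern n).1 (slicePattern n).2.1
      (slicePattern n).2.2 (baseList g hg), 0) : P2 g) : C12 g) ∈ C12deg g 4 :=
  mk_mem_C12deg g (sliceTh_mem_T4deg g _ (length_baseList g hg)
    (Nat.add_sub_cancel' (slicePattern_le n))) (Submodule.zero_mem _)

/-- The coordinates of an equivariant map `C₁₂^{(4)} → Λ⁴H`. -/
def equivCoords (g : ℕ) (hg : 2 ≤ g) : equivC12toLam g 4 4 →ₗ[ℚ] (Fin 6 → ℚ) :=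
  LinearMap.pi fun n => (lamBasis g 4).coord (baseSet g hg) ∘ₗ
    LinearMap.applyₗ (⟨_, mk_sliceTh_mem g hg n⟩ : C12deg g 4) ∘ₗ (equivC12toLam g 4 4).subtype

theorem equivCoords_apply (g : ℕ) (hg : 2 ≤ g) (π : equivC12toLam g 4 4) (n : Fin 6) :
    equivCoords g hg π n =
      (lamBasis g 4).coord (baseSet g hg) (π.1 ⟨_, mk_sliceTh_mem g hg n⟩) := rfl

set_option maxHeartbeats 1000000 in
theorem equivCoords_injective (g : ℕ) (hg : 2 ≤ g) : Function.Injective (equivCoords g hg) := by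
  rw [injective_iff_map_eq_zero]
  rintro ⟨π, hπ⟩ h0
  obtain ⟨π', hπ'⟩ := LinearMap.exists_extend π
  have hval : ∀ (y : C12 g) (hy : y ∈ C12deg g 4), π' y = π ⟨y, hy⟩ := fun y hy =>
    LinearMap.congr_fun hπ' ⟨y, hy⟩
  let P : T4 g →ₗ[ℚ] ⋀[ℚ]^4 (Hsp g) :=
    π' ∘ₗ (Submodule.span ℚ (C12Rel g)).mkQ ∘ₗ LinearMap.inl ℚ (T4 g) (T4 g)
  have hTh : ∀ t u v w : TA g, P (Th g t u v w) = π' (ThC g t u v w) := fun _ _ _ _ => rfl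
  have hP : ∀ (σ : Hsp g ≃ₗ[ℚ] Hsp g), ∀ x ∈ T4deg g 4,
      (P (T4map g σ.toLinearMap x) : ExteriorAlgebra ℚ (Hsp g)) =
        ExteriorAlgebra.map σ.toLinearMap (P x) := by
    intro σ x hx
    have hmap : P2map g σ.toLinearMap ((x, 0) : P2 g) = (T4map g σ.toLinearMap x, 0) := by
      simp [P2map]
    have h₁ := mk_mem_C12deg g (p := (x, 0)) hx (Submodule.zero_mem _)
    have h₂ := mk_mem_C12deg g (p := P2map g σ.toLinearMap (x, 0)) (m := 4)
      (by rw [hmap]; exact T4map_mem_T4deg g _ hx) (by rw [hmap]; exact Submodule.zero_mem _)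
    have h := hπ σ (x, 0) h₁ h₂
    rw [← hval, ← hval, hmap] at h
    exact h
  have hf : IsThetaWeight (equivWeight g hg P) := by
    refine isThetaWeight_equivWeight g hg P hP (fun t u v w => ?_) (fun t u v w => ?_)
      fun t u v w a => ?_
    · rw [hTh, hTh, ThC_rot]
    · rw [hTh, hTh, ThC_flip]
    · rw [hTh, hTh, hTh, hTh, ← map_sub, ← map_sub, ← map_add, ThC_hb, map_zero]
  have hcoord : ∀ n : Fin 6, (lamBasis g 4).coord (baseSet g hg)
      (P (sliceTh g (slicePattern n).1 (slicePattern n).2.1 (slicePattern n).2.2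
        (baseList g hg))) = 0 := by
    intro n
    have h := congrFun h0 n
    rw [equivCoords_apply, ← hval] at h
    exact h
  have hzero : equivWeight g hg P = 0 := hf.eq_zero
    ((if_pos rfl).trans (hcoord 0)) ((if_pos rfl).trans (hcoord 1)) ((if_pos rfl).trans (hcoord 2))
    ((if_pos rfl).trans (hcoord 3)) ((if_pos rfl).trans (hcoord 4)) ((if_pos rfl).trans (hcoord 5))
  have hP0 : ∀ x ∈ T4deg g 4, P x = 0 := by
    intro x hx
    have h := eq_wedge4_of_equivariant g hg P hP x hx
    rw [hzero, wedge4_zero, LinearMap.zero_apply] at h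
    exact Subtype.ext h
  refine Subtype.ext (LinearMap.ext fun y => ?_)
  have h := eq_zero_of_theta_eq_zero g 4 π' hP0 y.1 y.2
  rwa [hval y.1 y.2] at h

/-! ### Construction of equivariant maps -/

theorem IsThetaWeight.twistRot_eq {f : ℕ → ℕ → ℕ → ℕ → ℚ} (hf : IsThetaWeight f) :
    twistRot f = f := by
  funext i j k l
  by_cases h : i + j + k + l = 4
  · exact (hf.rot i j k l h).symm
  · rw [twistRot, hf.support k l i j (by omega), hf.support i j k l h, mul_zero]

theorem IsThetaWeight.twistFlip_eq {f : ℕ → ℕ → ℕ → ℕ → ℚ} (hf : IsThetaWeight f) :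
    twistFlip f = f := by
  funext i j k l
  by_cases h : i + j + k + l = 4
  · exact (hf.flip i j k l h).symm
  · rw [twistFlip, hf.support j i l k (by omega), hf.support i j k l h, mul_zero]

theorem IsThetaWeight.hbWeight_eq {f : ℕ → ℕ → ℕ → ℕ → ℚ} (hf : IsThetaWeight f) :
    hbWeight f = 0 := by
  funext i j k l
  by_cases h : i + j + k + l = 3
  · exact hf.hb i j k l h
  · rw [hbWeight, hf.support i j k (l + 1) (by omega), hf.support i j (k + 1) l (by omega),
      hf.support i (j + 1) k l (by omega), hf.support (i + 1) j k l (by omega)]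
    simp

/-- The map on the presentation space of `C₁₂` attached to a weight on the theta generators. -/
def wedgeP2 (g : ℕ) (f : ℕ → ℕ → ℕ → ℕ → ℚ) : P2 g →ₗ[ℚ] ExteriorAlgebra ℚ (Hsp g) :=
  (wedge4 g f).coprod (wedge4 g (f + twistSwap f))

theorem wedgeP2_ThP (g : ℕ) (f : ℕ → ℕ → ℕ → ℕ → ℚ) (t u v w : TA g) :
    wedgeP2 g f (ThP g t u v w) = wedge4 g f (Th g t u v w) := by
  simp [wedgeP2, ThP]

theorem wedgeP2_DP (g : ℕ) (f : ℕ → ℕ → ℕ → ℕ → ℚ) (t u v w : TA g) :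
    wedgeP2 g f (DP g t u v w) =
      wedge4 g f (Th g t u v w) + wedge4 g f (Th g (barT g v) u (barT g t) w) := by
  simp [wedgeP2, DP, wedge4_add, wedge4_swap]

theorem span_C12Rel_le_ker_wedgeP2 (g : ℕ) {f : ℕ → ℕ → ℕ → ℕ → ℚ} (hf : IsThetaWeight f) :
    Submodule.span ℚ (C12Rel g) ≤ LinearMap.ker (wedgeP2 g f) := by
  have rot : ∀ t u v w : TA g, wedge4 g f (Th g (barT g v) (barT g w) (barT g t) (barT g u)) =
      wedge4 g f (Th g t u v w) := fun t u v w => by rw [wedge4_rot, hf.twistRot_eq]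
  have flip : ∀ t u v w : TA g, wedge4 g f (Th g (barT g u) (barT g t) (barT g w) (barT g v)) =
      wedge4 g f (Th g t u v w) := fun t u v w => by rw [wedge4_flip, hf.twistFlip_eq]
  have hb : ∀ (t u v w : TA g) (a : Hsp g), wedge4 g f (Th g t u v (w * TensorAlgebra.ι ℚ a))
      - wedge4 g f (Th g t u (TensorAlgebra.ι ℚ a * v) w)
      - wedge4 g f (Th g t (TensorAlgebra.ι ℚ a * u) v w)
      + wedge4 g f (Th g (t * TensorAlgebra.ι ℚ a) u v w) = 0 := fun t u v w a => by
    rw [wedge4_hb g f hf.support, hf.hbWeight_eq, wedge4_zero, LinearMap.zero_apply, zero_mul]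
  have neg₁ : ∀ t u v w : TA g, wedge4 g f (Th g (-t) u v w) = -wedge4 g f (Th g t u v w) :=
    fun t u v w => by rw [Th, TensorProduct.neg_tmul, map_neg, Th]
  have neg₃ : ∀ t u v w : TA g, wedge4 g f (Th g t u (-v) w) = -wedge4 g f (Th g t u v w) :=
    fun t u v w => by
      rw [Th, TensorProduct.neg_tmul, TensorProduct.tmul_neg, TensorProduct.tmul_neg, map_neg, Th]
  refine Submodule.span_le.mpr fun x hx => LinearMap.mem_ker.mpr ?_
  rcases hx with ⟨t, u, v, w, rfl⟩ | ⟨t, u, v, w, rfl⟩ | ⟨t, u, v, w, rfl⟩ | ⟨t, u, v, w, rfl⟩ |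
    ⟨t, u, v, w, a, rfl⟩ | ⟨t, u, v, w, a, rfl⟩ | ⟨t, u, v, w, rfl⟩
  · rw [map_sub, wedgeP2_ThP, wedgeP2_ThP, rot, sub_self]
  · rw [map_sub, wedgeP2_ThP, wedgeP2_ThP, flip, sub_self]
  · rw [map_sub, wedgeP2_DP, wedgeP2_DP, barT_barT, barT_barT, add_comm, sub_self]
  · have h₁ := rot (barT g u) v (barT g w) t
    have h₂ := flip (barT g v) u (barT g t) w
    simp only [barT_barT] at h₁ h₂
    rw [map_sub, wedgeP2_DP, wedgeP2_DP, flip, barT_barT, barT_barT, h₁, h₂, sub_self]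
  · rw [map_add, map_sub, map_sub, wedgeP2_ThP, wedgeP2_ThP, wedgeP2_ThP, wedgeP2_ThP, hb]
  · have h₁ := hb t u v w a
    have h₂ := hb (barT g v) u (barT g t) w a
    rw [map_add, map_sub, map_sub, wedgeP2_DP, wedgeP2_DP, wedgeP2_DP, wedgeP2_DP, barT_mul,
      barT_mul, barT_ι, mul_neg, neg_mul, neg₁, neg₃]
    refine Eq.trans ?_ ((congrArg₂ (fun y z => -y - z) h₁ h₂).trans (by rw [neg_zero, sub_zero]))
    abel
  · rw [map_sub, map_sub, wedgeP2_DP, wedgeP2_ThP, wedgeP2_ThP]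
    abel

theorem wedgeP2_mem (g : ℕ) {f : ℕ → ℕ → ℕ → ℕ → ℚ} (hf : IsThetaWeight f) (p : P2 g) :
    wedgeP2 g f p ∈ ⋀[ℚ]^4 (Hsp g) := by
  refine Submodule.add_mem _ (wedge4_mem g f hf.support p.1) (wedge4_mem g _ ?_ p.2)
  intro i j k l h
  rw [Pi.add_apply, Pi.add_apply, Pi.add_apply, Pi.add_apply, twistSwap, hf.support i j k l h,
    hf.support k j i l (by omega), mul_zero, add_zero]

theorem wedgeP2_P2map (g : ℕ) (f : ℕ → ℕ → ℕ → ℕ → ℚ) (φ : Hsp g →ₗ[ℚ] Hsp g) (p : P2 g) :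
    wedgeP2 g f (P2map g φ p) = ExteriorAlgebra.map φ (wedgeP2 g f p) := by
  simp [wedgeP2, P2map, wedge4_T4map]

/-- The map on `C₁₂` attached to a theta weight. -/
def wedgeC12 (g : ℕ) {f : ℕ → ℕ → ℕ → ℕ → ℚ} (hf : IsThetaWeight f) :
    C12 g →ₗ[ℚ] ⋀[ℚ]^4 (Hsp g) :=
  ((Submodule.span ℚ (C12Rel g)).liftQ (wedgeP2 g f)
    (span_C12Rel_le_ker_wedgeP2 g hf)).codRestrict _ fun y => by
      obtain ⟨p, rfl⟩ := Submodule.Quotient.mk_surjective _ y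
      exact wedgeP2_mem g hf p

theorem coe_wedgeC12_mk (g : ℕ) {f : ℕ → ℕ → ℕ → ℕ → ℚ} (hf : IsThetaWeight f) (p : P2 g) :
    (wedgeC12 g hf (Submodule.Quotient.mk p) : ExteriorAlgebra ℚ (Hsp g)) = wedgeP2 g f p := rfl

theorem wedgeC12_mem_equivC12toLam (g : ℕ) {f : ℕ → ℕ → ℕ → ℕ → ℚ} (hf : IsThetaWeight f) :
    (wedgeC12 g hf).domRestrict (C12deg g 4) ∈ equivC12toLam g 4 4 := by
  intro σ p hx hy
  rw [LinearMap.domRestrict_apply, LinearMap.domRestrict_apply, coe_wedgeC12_mk, coe_wedgeC12_mk,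
    wedgeP2_P2map]

theorem wedge4_sliceTh_baseList (g : ℕ) (hg : 2 ≤ g) (f : ℕ → ℕ → ℕ → ℕ → ℚ) {i j k l : ℕ}
    (h : i + j + k + l = 4) :
    wedge4 g f (sliceTh g i j k (baseList g hg)) = f i j k l • wedgeMon g (baseList g hg) := by
  obtain ⟨L₁, L₂, L₃, L₄, rfl, rfl, rfl, rfl, hL⟩ := exists_baseList_slices g hg i j k l h
  rw [← hL, sliceTh_append, wedge4_mon g _ _ _ _ _ h.le]

theorem thetaWeight_slicePattern (x : Fin 6 → ℚ) (n : Fin 6) :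
    thetaWeight x (slicePattern n).1 (slicePattern n).2.1 (slicePattern n).2.2
      (4 - ((slicePattern n).1 + (slicePattern n).2.1 + (slicePattern n).2.2)) = x n := by
  fin_cases n <;> simp [slicePattern, thetaWeight]

theorem equivCoords_surjective (g : ℕ) (hg : 2 ≤ g) : Function.Surjective (equivCoords g hg) := by
  intro x
  have hf := isThetaWeight_thetaWeight x
  refine ⟨⟨_, wedgeC12_mem_equivC12toLam g hf⟩, funext fun n => ?_⟩
  have hval : wedgeC12 g hf (Submodule.Quotient.mk ((sliceTh g (slicePattern n).1
      (slicePattern n).2.1 (slicePattern n).2.2 (baseList g hg), 0) : P2 g)) =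
      x n • lamBasis g 4 (baseSet g hg) := by
    refine Subtype.ext ?_
    rw [coe_wedgeC12_mk, wedgeP2, LinearMap.coprod_apply, map_zero, add_zero,
      wedge4_sliceTh_baseList g hg _ (Nat.add_sub_cancel' (slicePattern_le n)),
      thetaWeight_slicePattern, wedgeMon_baseList, Submodule.coe_smul]
  rw [equivCoords_apply, LinearMap.domRestrict_apply, hval, map_smul, Module.Basis.coord_apply,
    Module.Basis.repr_self, Finsupp.single_eq_same, smul_eq_mul, mul_one]

/-- Proposition 4.2: for every `g ≥ 2`, the space of `GL(H)`-equivariant linear maps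
from `C₁₂^{(4)}` (total tensor degree 4, Lie degree 6) to `Λ⁴H` has dimension `6`;
equivalently, the multiplicity of `[1⁴] = Λ⁴H` in `C_{1,2}ℋ(6)` is `6`. -/
theorem multiplicity_of_lambda4_in_C12_degree6 (g : ℕ) (hg : 2 ≤ g) :
    Module.finrank ℚ ↥(equivC12toLam g 4 4) = 6 := by
  rw [(LinearEquiv.ofBijective (equivCoords g hg)
    ⟨equivCoords_injective g hg, equivCoords_surjective g hg⟩).finrank_eq, Module.finrank_fin_fun]
end
end
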